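/- arXiv:1610.00367 — 3 statements merged into one kernel-verified Lean document; each statement's English description precedes it below -/
import Mathlib

section
/- Let s be a nonzero algebraic number that is not a root of unity, and let P(x) ∈ ℚ̄[x] be a polynomial of degree d ≥ 1. If there exist infinitely many pairs (m, n) ∈ ℕ₀ × ℕ₀ with P(n) = s^m, then there exist a, b ∈ ℚ̄ such that P(x) = a·(x - b)^d. -/
open Polynomial

attribute [local instance] Matrix.normedAddCommGroup

lemma aux_siegel {α β : Type} [Fintype α] [Fintype β] (A : Matrix α β ℤ) (M E : ℕ) (hM : 1 ≤ M)
    (hA : ∀ i j, |A i j| ≤ (M : ℤ)) (hn : Fintype.card α < Fintype.card β)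
    (hm : 0 < Fintype.card α)
    (hE : Fintype.card α ≤ E * (Fintype.card β - Fintype.card α)) :
    ∃ t : β → ℤ, t ≠ 0 ∧ A.mulVec t = 0 ∧ ∀ j, |t j| ≤ (((Fintype.card β * M) ^ E : ℕ) : ℤ) := by
  obtain ⟨t, h0, h1, h2⟩ := Int.Matrix.exists_ne_zero_int_vec_norm_le A hn hm
  refine ⟨t, h0, h1, fun j => ?_⟩
  have h3 : ‖t j‖ ≤ ‖t‖ := norm_le_pi_norm t j
  have h4 : ‖A‖ ≤ M := by
    rw [Matrix.norm_le_iff (by positivity)]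
    intro i j
    rw [Int.norm_eq_abs]
    exact_mod_cast hA i j
  have h5 : ((Fintype.card β : ℝ) * max 1 ‖A‖) ≤ Fintype.card β * M := by
    gcongr
    exact max_le (by exact_mod_cast hM) h4
  have hb : (1:ℝ) ≤ Fintype.card β := by exact_mod_cast (by omega : 1 ≤ Fintype.card β)
  have h6 : (1:ℝ) ≤ (Fintype.card β : ℝ) * max 1 ‖A‖ := by
    have := le_max_left 1 ‖A‖
    nlinarith
  have hpos : (0:ℝ) < (Fintype.card β : ℝ) - Fintype.card α := by
    have : (Fintype.card α : ℝ) < Fintype.card β := by exact_mod_cast hn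
    linarith
  have h7 : ((Fintype.card α : ℝ) / ((Fintype.card β : ℝ) - Fintype.card α)) ≤ E := by
    rw [div_le_iff₀ hpos]
    rw [← Nat.cast_sub hn.le]
    exact_mod_cast hE
  have h8 : ‖t‖ ≤ ((Fintype.card β : ℝ) * M) ^ E := by
    refine h2.trans ?_
    calc _ ≤ ((Fintype.card β : ℝ) * max 1 ‖A‖) ^ (E : ℝ) := Real.rpow_le_rpow_of_exponent_le h6 h7
      _ = ((Fintype.card β : ℝ) * max 1 ‖A‖) ^ E := Real.rpow_natCast _ _
      _ ≤ _ := by gcongr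
  have h9 := h3.trans h8
  rw [Int.norm_eq_abs] at h9
  exact_mod_cast h9

lemma aux_powmod (f : ℤ[X]) (hf : f.Monic) :
    ∃ B : ℕ, 1 ≤ B ∧ ∀ i l, |((X ^ i) %ₘ f).coeff l| ≤ (B : ℤ) ^ i := by
  by_cases hf1 : f = 1
  · refine ⟨1, le_rfl, fun i l => ?_⟩
    simp [hf1]
  have hdeg : 0 < f.natDegree := by
    rcases Nat.eq_zero_or_pos f.natDegree with h | h
    · exact absurd (hf.natDegree_eq_zero.1 h) hf1
    · exact h
  set s : ℕ := ∑ j ∈ f.support, (f.coeff j).natAbs with hs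
  have hcoef : ∀ j, |f.coeff j| ≤ (s : ℤ) := by
    intro j
    by_cases hj : j ∈ f.support
    · have : (f.coeff j).natAbs ≤ s :=
        Finset.single_le_sum (f := fun j => (f.coeff j).natAbs) (fun _ _ => Nat.zero_le _) hj
      rw [Int.abs_eq_natAbs]; exact_mod_cast this
    · rw [notMem_support_iff.1 hj]; simp
  refine ⟨1 + s, by omega, fun i => ?_⟩
  induction i with
  | zero =>
    intro l
    have : (1 : ℤ[X]) %ₘ f = 1 := by
      rw [modByMonic_eq_self_iff hf]
      rw [degree_one]
      exact natDegree_pos_iff_degree_pos.1 hdeg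
    simp only [pow_zero, this, coeff_one]
    split_ifs <;> simp
  | succ i ih =>
    intro l
    set p := (X ^ i : ℤ[X]) %ₘ f with hp
    have hpd : p.degree < f.degree := degree_modByMonic_lt _ hf
    set c := p.coeff (f.natDegree - 1) with hc
    have key : (X ^ (i+1) : ℤ[X]) %ₘ f = X * p - C c * f := by
      have hdiv := modByMonic_add_div (X ^ i : ℤ[X]) f
      refine (div_modByMonic_unique (X * (X ^ i /ₘ f) + C c) (X * p - C c * f) hf ⟨?_, ?_⟩).2
      · rw [pow_succ]
        rw [← hp] at hdiv
        linear_combination X * hdiv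
      · rw [degree_eq_natDegree hf.ne_zero, degree_lt_iff_coeff_zero]
        intro m hm
        have hd : f.natDegree ≤ m := hm
        obtain ⟨m', rfl⟩ : ∃ m', m = m' + 1 := ⟨m - 1, by omega⟩
        rw [coeff_sub, coeff_X_mul, coeff_C_mul]
        rcases hd.eq_or_lt with h | h
        · have : c = p.coeff m' := by rw [hc, h]; simp
          rw [← this, ← h]
          have : f.coeff f.natDegree = 1 := hf
          rw [this]; ring
        · rw [coeff_eq_zero_of_natDegree_lt h]
          rw [coeff_eq_zero_of_degree_lt]
          · simp
          · refine hpd.trans_le ?_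
            rw [degree_eq_natDegree hf.ne_zero]
            exact_mod_cast (by omega)
    rw [key, coeff_sub, coeff_C_mul]
    have h1 : |(X * p).coeff l| ≤ (((1 + s : ℕ) : ℤ)) ^ i := by
      cases l with
      | zero => simp; positivity
      | succ l => rw [coeff_X_mul]; exact ih l
    have h2 : |c * f.coeff l| ≤ (((1 + s : ℕ) : ℤ)) ^ i * s := by
      rw [abs_mul]
      exact mul_le_mul (ih _) (hcoef l) (abs_nonneg _) (by positivity)
    calc _ ≤ |(X * p).coeff l| + |c * f.coeff l| := abs_sub _ _
      _ ≤ (((1 + s : ℕ) : ℤ)) ^ i + (((1 + s : ℕ) : ℤ)) ^ i * s := add_le_add h1 h2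
      _ = _ := by push_cast; ring

lemma aux_poly (f : ℤ[X]) (hf : f.Monic) (B0 : ℕ) (hB : 1 ≤ B0)
    (hB0 : ∀ i l, |((X ^ i) %ₘ f).coeff l| ≤ (B0 : ℤ) ^ i) (a b r E : ℕ) (hba : b + 1 ≤ a)
    (hr : 0 < r) (hd : 0 < f.natDegree) (hlt : r * f.natDegree < a + b + 2)
    (hE : r * f.natDegree ≤ E * (a + b + 2 - r * f.natDegree)) :
    ∃ A B : ℤ[X], (A ≠ 0 ∨ B ≠ 0) ∧ A.natDegree ≤ a ∧ B.natDegree ≤ b ∧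
      (∀ i, |A.coeff i| ≤ ((((a + b + 2) * (2 * B0) ^ (a + 1)) ^ E : ℕ) : ℤ)) ∧
      (∀ i, |B.coeff i| ≤ ((((a + b + 2) * (2 * B0) ^ (a + 1)) ^ E : ℕ) : ℤ)) ∧
      ∀ k < r, f ∣ hasseDeriv k A - X * hasseDeriv k B := by
  let p : ℕ → (Fin (a+1) ⊕ Fin (b+1)) → ℤ[X] := fun k j =>
    Sum.elim (fun i : Fin (a+1) => ((i.1.choose k : ℕ) : ℤ) • (X ^ (i.1 - k) : ℤ[X]))
      (fun i : Fin (b+1) => (-((i.1.choose k : ℕ) : ℤ)) • (X ^ (i.1 - k + 1) : ℤ[X])) j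
  let Mx : Matrix (Fin r × Fin f.natDegree) (Fin (a+1) ⊕ Fin (b+1)) ℤ :=
    fun kl j => (p kl.1 j %ₘ f).coeff kl.2
  have hcard1 : Fintype.card (Fin r × Fin f.natDegree) = r * f.natDegree := by simp
  have hcard2 : Fintype.card (Fin (a+1) ⊕ Fin (b+1)) = a + b + 2 := by simp; ring
  have hent : ∀ i j, |Mx i j| ≤ (((2 * B0) ^ (a+1) : ℕ) : ℤ) := by
    rintro ⟨k, l⟩ j
    have gen : ∀ i e : ℕ, i ≤ a + 1 → e ≤ a + 1 → ((i.choose k : ℕ) : ℤ) * |((X ^ e : ℤ[X]) %ₘ f).coeff l|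
        ≤ (((2 * B0) ^ (a+1) : ℕ) : ℤ) := by
      intro i e hi he
      have h1 : ((i.choose k : ℕ) : ℤ) ≤ 2 ^ (a+1) := by
        have : i.choose k ≤ 2 ^ (a+1) :=
          (Nat.choose_le_two_pow _ _).trans (Nat.pow_le_pow_right (by norm_num) hi)
        exact_mod_cast this
      have h2 : |((X ^ e : ℤ[X]) %ₘ f).coeff l| ≤ (B0:ℤ) ^ (a+1) := by
        refine (hB0 e l).trans ?_
        exact pow_le_pow_right₀ (by exact_mod_cast hB) he
      rw [mul_pow]; push_cast
      exact mul_le_mul h1 h2 (abs_nonneg _) (by positivity)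
    rcases j with i | i
    · have : Mx (k, l) (Sum.inl i) = ((i.1.choose k : ℕ) : ℤ) * ((X ^ (i.1 - k) : ℤ[X]) %ₘ f).coeff l := by
        simp only [Mx, p, Sum.elim_inl, smul_modByMonic, coeff_smul, smul_eq_mul]
      rw [this, abs_mul, Nat.abs_cast]
      exact gen _ _ (by omega) (by omega)
    · have : Mx (k, l) (Sum.inr i) = -((i.1.choose k : ℕ) : ℤ) * ((X ^ (i.1 - k + 1) : ℤ[X]) %ₘ f).coeff l := by
        simp only [Mx, p, Sum.elim_inr, smul_modByMonic, coeff_smul, smul_eq_mul]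
      rw [this, abs_mul, abs_neg, Nat.abs_cast]
      exact gen _ _ (by omega) (by omega)
  obtain ⟨t, ht0, ht1, ht2⟩ := aux_siegel Mx ((2 * B0) ^ (a+1)) E (Nat.one_le_pow _ _ (by omega)) hent
    (by rw [hcard1, hcard2]; exact hlt) (by rw [hcard1]; positivity)
    (by rw [hcard1, hcard2]; exact hE)
  rw [hcard2] at ht2
  let A : ℤ[X] := ∑ i : Fin (a+1), monomial i.1 (t (Sum.inl i))
  let B : ℤ[X] := ∑ i : Fin (b+1), monomial i.1 (t (Sum.inr i))
  have hAc : ∀ n, A.coeff n = if h : n < a + 1 then t (Sum.inl ⟨n, h⟩) else 0 := by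
    intro n
    simp only [A, finsetSum_coeff, coeff_monomial]
    split_ifs with h
    · rw [Finset.sum_eq_single ⟨n, h⟩]
      · simp
      · intro j _ hj
        rw [if_neg]; intro h'; exact hj (Fin.ext h')
      · simp
    · apply Finset.sum_eq_zero
      intro j _
      rw [if_neg]; have := j.2; omega
  have hBc : ∀ n, B.coeff n = if h : n < b + 1 then t (Sum.inr ⟨n, h⟩) else 0 := by
    intro n
    simp only [B, finsetSum_coeff, coeff_monomial]
    split_ifs with h
    · rw [Finset.sum_eq_single ⟨n, h⟩]
      · simp
      · intro j _ hj
        rw [if_neg]; intro h'; exact hj (Fin.ext h')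
      · simp
    · apply Finset.sum_eq_zero
      intro j _
      rw [if_neg]; have := j.2; omega
  refine ⟨A, B, ?_, ?_, ?_, ?_, ?_, ?_⟩
  · by_contra! hcon
    apply ht0
    funext j
    rcases j with i | i
    · have := hAc i.1
      rw [hcon.1, dif_pos i.2] at this
      simpa using this.symm
    · have := hBc i.1
      rw [hcon.2, dif_pos i.2] at this
      simpa using this.symm
  · rw [natDegree_le_iff_coeff_eq_zero]
    intro n hn
    rw [hAc, dif_neg (by omega)]
  · rw [natDegree_le_iff_coeff_eq_zero]
    intro n hn
    rw [hBc, dif_neg (by omega)]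
  · intro n
    rw [hAc]
    split_ifs
    · exact ht2 _
    · simp only [abs_zero]; positivity
  · intro n
    rw [hBc]
    split_ifs
    · exact ht2 _
    · simp only [abs_zero]; positivity
  · intro k hk
    have hexp : hasseDeriv k A - X * hasseDeriv k B = ∑ j, t j • p k j := by
      simp only [A, B, map_sum, hasseDeriv_monomial, Fintype.sum_sum_type, p, Sum.elim_inl,
        Sum.elim_inr, Finset.mul_sum, X_mul_monomial, sub_eq_add_neg, ← Finset.sum_neg_distrib]
      congr 1
      · apply Finset.sum_congr rfl
        intro i _
        rw [smul_smul, X_pow_eq_monomial, smul_monomial]; simp [mul_comm]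
      · apply Finset.sum_congr rfl
        intro i _
        rw [smul_smul, X_pow_eq_monomial, smul_monomial, ← monomial_neg]; simp [mul_comm]
    rw [← modByMonic_eq_zero_iff_dvd hf, hexp]
    ext l
    have hlin : (∑ j, t j • p k j) %ₘ f = ∑ j, t j • (p k j %ₘ f) := by
      have := map_sum (modByMonicHom f) (fun j => t j • p k j) Finset.univ
      simp only [modByMonicHom_apply, smul_modByMonic] at this
      exact this
    by_cases hl : l < f.natDegree
    · have := congrFun ht1 (⟨k, hk⟩, ⟨l, hl⟩)
      rw [hlin, finsetSum_coeff]
      simp only [Matrix.mulVec, dotProduct, Mx, Pi.zero_apply] at this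
      simp only [coeff_smul, smul_eq_mul, coeff_zero]
      rw [← this]
      exact Finset.sum_congr rfl fun _ _ => mul_comm _ _
    · rw [coeff_zero]
      apply coeff_eq_zero_of_degree_lt
      refine (degree_modByMonic_lt _ hf).trans_le ?_
      rw [degree_eq_natDegree hf.ne_zero]
      exact_mod_cast (by omega)

lemma aux_sum_le (s : Finset ℂ) (e : ℂ → ℕ) (G : ℂ[X]) (hG : G ≠ 0)
    (h : ∀ α ∈ s, (X - C α) ^ e α ∣ G) : ∑ α ∈ s, e α ≤ G.natDegree := by
  have h1 : ∏ α ∈ s, (X - C α) ^ e α ∣ G := by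
    apply Finset.prod_dvd_of_coprime _ h
    intro α _ β _ hab
    exact (isCoprime_X_sub_C_of_isUnit_sub (sub_ne_zero.2 hab).isUnit).pow
  have h2 := natDegree_le_of_dvd h1 hG
  rw [natDegree_prod_of_monic _ _ (fun α _ => (monic_X_sub_C α).pow _)] at h2
  simpa using h2

lemma aux_hasse_dvd {R : Type*} [CommRing R] (G : R[X]) (α : R) (r : ℕ)
    (h : ∀ k < r, (hasseDeriv k G).eval α = 0) : (X - C α) ^ r ∣ G := by
  rw [X_sub_C_pow_dvd_iff, X_pow_dvd_iff]
  intro k hk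
  rw [← taylor_apply, taylor_coeff]
  exact h k hk

lemma aux_wronsk (A B : ℂ[X]) (α c : ℂ) (r : ℕ) (h : (X - C α) ^ r ∣ A - C c * B) :
    (X - C α) ^ (r - 1) ∣ wronskian A B := by
  have h1 : (X - C α) ^ (r - 1) ∣ derivative (A - C c * B) :=
    pow_sub_one_dvd_derivative_of_pow_dvd h
  have h2 : (X - C α) ^ (r - 1) ∣ A - C c * B := (pow_dvd_pow _ (Nat.sub_le _ _)).trans h
  have : wronskian A B = (A - C c * B) * derivative B - derivative (A - C c * B) * B := by
    simp only [wronskian, derivative_sub, derivative_mul, derivative_C]; ring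
  rw [this]
  exact dvd_sub (h2.mul_right _) (h1.mul_right _)

lemma aux_hasse_map {R S : Type*} [CommRing R] [CommRing S] (φ : R →+* S) (k : ℕ) (G : R[X]) :
    hasseDeriv k (G.map φ) = (hasseDeriv k G).map φ := by
  ext n
  simp [hasseDeriv_coeff]

lemma aux_gcd (A B : ℂ[X]) (h : A ≠ 0 ∨ B ≠ 0) :
    ∃ g A1 B1 : ℂ[X], g ≠ 0 ∧ IsCoprime A1 B1 ∧ A = g * A1 ∧ B = g * B1 := by
  have hg0 : EuclideanDomain.gcd A B ≠ 0 := by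
    intro h'; rw [EuclideanDomain.gcd_eq_zero_iff] at h'; tauto
  obtain ⟨A1, hA1⟩ := EuclideanDomain.gcd_dvd_left A B
  obtain ⟨B1, hB1⟩ := EuclideanDomain.gcd_dvd_right A B
  have hbez := EuclideanDomain.gcd_eq_gcd_ab A B
  generalize EuclideanDomain.gcd A B = g at *
  refine ⟨g, A1, B1, hg0, ⟨EuclideanDomain.gcdA A B, EuclideanDomain.gcdB A B, ?_⟩, hA1, hB1⟩
  generalize EuclideanDomain.gcdA A B = u at *
  generalize EuclideanDomain.gcdB A B = v at *
  apply mul_left_cancel₀ hg0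
  linear_combination (-1 : ℂ[X]) * hbez - u * hA1 - v * hB1

lemma aux_nonvanish (f : ℤ[X]) (hf : f.Monic) (hsep : (f.map (Int.castRingHom ℂ)).Separable)
    (A B : ℤ[X]) (a b r J : ℕ) (hAB : A ≠ 0 ∨ B ≠ 0) (hA : A.natDegree ≤ a) (hB : B.natDegree ≤ b)
    (h : ∀ k < r, f ∣ hasseDeriv k A - X * hasseDeriv k B) (N y : ℤ) (hN : f.eval N ≠ 0)
    (hb : b < r * (f.natDegree - 1)) (ha : a < r * f.natDegree)
    (hJ : a + b < (r - 1) * f.natDegree + J) :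
    ∃ j ≤ J, (hasseDeriv j A).eval N - y * (hasseDeriv j B).eval N ≠ 0 := by
  by_contra! hcon
  set φ := Int.castRingHom ℂ with hφ
  have hinj : Function.Injective φ := Int.cast_injective
  set A' := A.map φ with hA'
  set B' := B.map φ with hB'
  set s := (f.map φ).roots.toFinset with hs
  have hf0 : f.map φ ≠ 0 := (hf.map φ).ne_zero
  have hcard : s.card = f.natDegree := by
    rw [hs, Multiset.toFinset_card_of_nodup (nodup_roots hsep),
      ← (IsAlgClosed.splits (f.map φ)).natDegree_eq_card_roots, hf.natDegree_map]
  have hroot : ∀ α ∈ s, (X - C α) ^ r ∣ A' - C α * B' := by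
    intro α hα
    have hα' : (f.map φ).eval α = 0 := by
      rw [hs, Multiset.mem_toFinset, mem_roots hf0] at hα
      exact hα
    apply aux_hasse_dvd
    intro k hk
    obtain ⟨g, hg⟩ := h k hk
    have := congrArg (fun p => (p.map φ).eval α) hg
    simp only [Polynomial.map_sub, Polynomial.map_mul, map_X, eval_sub, eval_mul, eval_X, hα',
      zero_mul] at this
    rw [map_sub, ← smul_eq_C_mul, map_smul, eval_sub, eval_smul, hA', hB', aux_hasse_map,
      aux_hasse_map, smul_eq_mul, this]
  have hNd : (X - C (φ N)) ^ (J + 1) ∣ A' - C (φ y) * B' := by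
    apply aux_hasse_dvd
    intro k hk
    rw [map_sub, ← smul_eq_C_mul, map_smul, eval_sub, eval_smul, hA', hB', aux_hasse_map,
      aux_hasse_map, smul_eq_mul]
    have := congrArg φ (hcon k (by omega))
    rw [map_sub, map_mul, map_zero] at this
    rw [eval_map_apply, eval_map_apply, this]
  have hA'd : A'.natDegree ≤ a := natDegree_map_le.trans hA
  have hB'd : B'.natDegree ≤ b := natDegree_map_le.trans hB
  by_cases hW : wronskian A' B' = 0
  · have hAB' : A' ≠ 0 ∨ B' ≠ 0 := by
      rcases hAB with h | h
      · left; exact (Polynomial.map_ne_zero_iff hinj).2 h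
      · right; exact (Polynomial.map_ne_zero_iff hinj).2 h
    obtain ⟨g, A1, B1, hg0, hcop, hA1, hB1⟩ : ∃ g A1 B1 : ℂ[X], g ≠ 0 ∧ IsCoprime A1 B1 ∧ A' = g * A1 ∧ B' = g * B1 :=
      aux_gcd A' B' hAB'
    have hW1 : wronskian A1 B1 = 0 := by
      have : wronskian A' B' = g ^ 2 * wronskian A1 B1 := by
        rw [hA1, hB1]; simp only [wronskian, derivative_mul]; ring
      rw [this] at hW
      exact (mul_eq_zero.1 hW).resolve_left (pow_ne_zero _ hg0)
    obtain ⟨hdA, hdB⟩ := hcop.wronskian_eq_zero_iff.1 hW1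
    obtain ⟨a1, rfl⟩ : ∃ a1, A1 = C a1 := ⟨_, eq_C_of_derivative_eq_zero hdA⟩
    obtain ⟨b1, rfl⟩ : ∃ b1, B1 = C b1 := ⟨_, eq_C_of_derivative_eq_zero hdB⟩
    have key : ∀ α ∈ s, a1 - α * b1 ≠ 0 → (X - C α) ^ r ∣ g := by
      intro α hα hne
      have h1 := hroot α hα
      rw [hA1, hB1, show g * C a1 - C α * (g * C b1) = g * C (a1 - α * b1) by
        simp only [C_sub, C_mul]; ring] at h1
      exact (IsUnit.dvd_mul_right (isUnit_C.2 hne.isUnit)).1 h1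
    by_cases hb1 : b1 = 0
    · have ha1 : a1 ≠ 0 := by
        rintro rfl
        rw [hA1, hB1, hb1] at hAB'; simp at hAB'
      have h1 := aux_sum_le s (fun _ => r) g hg0 (fun α hα => key α hα (by simp [hb1, ha1]))
      have h2 : A'.natDegree = g.natDegree := by rw [hA1, natDegree_mul_C ha1]
      rw [Finset.sum_const, smul_eq_mul, hcard, mul_comm] at h1
      omega
    · have h1 := aux_sum_le (s.erase (a1 / b1)) (fun _ => r) g hg0 (fun α hα => by
        rw [Finset.mem_erase] at hα
        refine key α hα.2 ?_
        intro h0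
        apply hα.1
        field_simp
        linear_combination -h0)
      have h2 : B'.natDegree = g.natDegree := by rw [hB1, natDegree_mul_C hb1]
      rw [Finset.sum_const, smul_eq_mul] at h1
      have h3 : s.card - 1 ≤ (s.erase (a1 / b1)).card := Finset.pred_card_le_card_erase
      rw [hcard] at h3
      have := Nat.mul_le_mul_right r h3
      rw [mul_comm] at hb
      omega
  · have hNs : φ N ∉ s := by
      rw [hs, Multiset.mem_toFinset, mem_roots hf0, IsRoot, eval_map_apply]
      exact fun h => hN (hinj (by rw [h, map_zero]))
    have hN2 := aux_wronsk A' B' (φ N) (φ y) (J + 1) hNd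
    rw [Nat.add_sub_cancel] at hN2
    have h1 := aux_sum_le (insert (φ N) s) (fun α => if α = φ N then J else r - 1) _ hW (by
      intro α hα
      rcases Finset.mem_insert.1 hα with hα | hα
      · rw [if_pos hα, hα]
        exact hN2
      · have hne : α ≠ φ N := fun h => hNs (h ▸ hα)
        rw [if_neg hne]
        exact aux_wronsk A' B' α α r (hroot α hα))
    rw [Finset.sum_insert hNs, if_pos rfl, Finset.sum_congr rfl (g := fun _ => r - 1)
      (fun α hα => if_neg (fun h : α = φ N => hNs (h ▸ hα))), Finset.sum_const, hcard, smul_eq_mul] at h1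
    have h2 : (wronskian A' B').natDegree < A'.natDegree + B'.natDegree := natDegree_wronskian_lt_add hW
    rw [mul_comm] at h1
    omega

lemma aux_arith (f A B : ℤ[X]) (r j : ℕ)
    (h : ∀ k < r, f ∣ hasseDeriv k A - X * hasseDeriv k B) (N y c : ℤ)
    (h1 : f.eval N ^ r ∣ c ^ r * f.eval y) (h2 : f.eval N ∣ c * (y - N)) :
    f.eval N ^ (r - j) ∣ c ^ r * ((hasseDeriv j A).eval N - y * (hasseDeriv j B).eval N) := by
  set G := A - C y * B with hG
  have e1 : (hasseDeriv j A).eval N - y * (hasseDeriv j B).eval N = (hasseDeriv j G).eval N := by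
    rw [hG, map_sub, ← smul_eq_C_mul, map_smul, eval_sub, eval_smul, smul_eq_mul]
  have e2 : (hasseDeriv j G).eval N = (taylor y (hasseDeriv j G)).eval (N - y) := by
    rw [taylor_eval]; simp
  rw [e1, e2, eval_eq_sum (p := taylor y (hasseDeriv j G)), Polynomial.sum, Finset.mul_sum]
  apply Finset.dvd_sum
  intro i _
  rw [taylor_coeff]
  by_cases hij : i + j < r
  · have e3 : hasseDeriv i (hasseDeriv j G) = (i + j).choose i • hasseDeriv (i + j) G := by
      rw [← LinearMap.comp_apply, hasseDeriv_comp]; rfl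
    have e4 : f.eval y ∣ (hasseDeriv (i + j) G).eval y := by
      obtain ⟨g, hg⟩ := h _ hij
      refine ⟨g.eval y, ?_⟩
      rw [← eval_mul, ← hg, hG, map_sub, ← smul_eq_C_mul, map_smul, eval_sub, eval_smul,
        smul_eq_mul, eval_sub, eval_mul, eval_X]
    rw [e3, eval_smul, nsmul_eq_mul]
    have e5 : f.eval N ^ (r - j) ∣ c ^ r * f.eval y := (pow_dvd_pow _ (Nat.sub_le _ _)).trans h1
    refine e5.trans ?_
    rw [mul_assoc]
    apply mul_dvd_mul_left
    exact Dvd.dvd.mul_left (e4.mul_right _) _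
  · have e6 : f.eval N ^ (r - j) ∣ (c * (y - N)) ^ (r - j) := pow_dvd_pow_of_dvd h2 _
    refine e6.trans ?_
    rw [mul_pow]
    apply mul_dvd_mul (pow_dvd_pow _ (Nat.sub_le _ _))
    apply Dvd.dvd.mul_left
    refine (pow_dvd_pow (y - N) (by omega : r - j ≤ i)).trans ?_
    apply pow_dvd_pow_of_dvd
    exact ⟨-1, by ring⟩


lemma aux_eval_bound (A : ℤ[X]) (a H j N : ℕ) (hN : 1 ≤ N) (hA : A.natDegree ≤ a)
    (hH : ∀ i, |A.coeff i| ≤ (H : ℤ)) :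
    |(hasseDeriv j A).eval (N : ℤ)| ≤ (4 : ℤ) ^ a * H * (N : ℤ) ^ a := by
  have hd : (hasseDeriv j A).natDegree < a + 1 := by
    have := natDegree_hasseDeriv_le A j; omega
  rw [eval_eq_sum_range' hd]
  have hN' : (1 : ℤ) ≤ N := by exact_mod_cast hN
  have hterm : ∀ i ∈ Finset.range (a + 1), |(hasseDeriv j A).coeff i * (N : ℤ) ^ i|
      ≤ 2 ^ a * H * (N : ℤ) ^ a := by
    intro i hi
    rw [Finset.mem_range] at hi
    rw [abs_mul, abs_pow, Nat.abs_cast]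
    apply mul_le_mul _ (pow_le_pow_right₀ hN' (by omega)) (by positivity) (by positivity)
    rw [hasseDeriv_coeff]
    by_cases h : i + j ≤ a
    · rw [abs_mul, Nat.abs_cast]
      refine mul_le_mul ?_ (hH _) (abs_nonneg _) (by positivity)
      have : (i + j).choose j ≤ 2 ^ a :=
        (Nat.choose_le_two_pow _ _).trans (Nat.pow_le_pow_right (by norm_num) h)
      exact_mod_cast this
    · rw [coeff_eq_zero_of_natDegree_lt (by omega)]
      simp
  calc _ ≤ ∑ i ∈ Finset.range (a + 1), |(hasseDeriv j A).coeff i * (N : ℤ) ^ i| :=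
        Finset.abs_sum_le_sum_abs _ _
    _ ≤ ∑ i ∈ Finset.range (a + 1), (2 ^ a * H * (N : ℤ) ^ a) := Finset.sum_le_sum hterm
    _ = ((a + 1 : ℕ) : ℤ) * (2 ^ a * H * (N : ℤ) ^ a) := by simp
    _ ≤ 2 ^ a * (2 ^ a * H * (N : ℤ) ^ a) := by
        gcongr
        exact_mod_cast (Nat.lt_two_pow_self : a < 2 ^ a)
    _ = _ := by rw [show (4:ℤ) = 2 * 2 by norm_num, mul_pow]; ring

lemma aux_growth (f : ℤ[X]) (hf : f.Monic) : ∃ Γ : ℕ, ∀ N : ℕ, Γ ≤ N →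
    (N : ℤ) ^ f.natDegree ≤ 2 * f.eval (N : ℤ) ∧ f.eval (N : ℤ) ≤ 2 * (N : ℤ) ^ f.natDegree := by
  set s : ℕ := ∑ j ∈ Finset.range f.natDegree, (f.coeff j).natAbs with hs
  refine ⟨2 * s + 1, fun N hN => ?_⟩
  have hN1 : (1 : ℤ) ≤ N := by exact_mod_cast (by omega : 1 ≤ N)
  have hN2 : (2 * s : ℤ) ≤ N := by exact_mod_cast (by omega : 2 * s ≤ N)
  have h1 : f.eval (N : ℤ) = ∑ i ∈ Finset.range f.natDegree, f.coeff i * (N : ℤ) ^ i +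
      (N : ℤ) ^ f.natDegree := by
    rw [eval_eq_sum_range, Finset.sum_range_succ]
    have : f.coeff f.natDegree = 1 := hf
    rw [this, one_mul]
  have h2 : 2 * |∑ i ∈ Finset.range f.natDegree, f.coeff i * (N : ℤ) ^ i| ≤ (N : ℤ) ^ f.natDegree := by
    rcases Nat.eq_zero_or_pos f.natDegree with h0 | h0
    · rw [h0]; simp
    have : |∑ i ∈ Finset.range f.natDegree, f.coeff i * (N : ℤ) ^ i| ≤
        s * (N : ℤ) ^ (f.natDegree - 1) := by
      refine (Finset.abs_sum_le_sum_abs _ _).trans ?_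
      rw [hs]; push_cast
      rw [Finset.sum_mul]
      apply Finset.sum_le_sum
      intro i hi
      rw [Finset.mem_range] at hi
      rw [abs_mul, abs_pow, Nat.abs_cast]
      exact mul_le_mul le_rfl (pow_le_pow_right₀ hN1 (by omega)) (by positivity) (by positivity)
    calc _ ≤ 2 * (s * (N : ℤ) ^ (f.natDegree - 1)) := by linarith
      _ = (2 * s) * (N : ℤ) ^ (f.natDegree - 1) := by ring
      _ ≤ N * (N : ℤ) ^ (f.natDegree - 1) := by gcongr
      _ = (N : ℤ) ^ (f.natDegree - 1 + 1) := by ring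
      _ = _ := by rw [Nat.sub_add_cancel h0]
  have h3 := abs_le.1 (le_refl |∑ i ∈ Finset.range f.natDegree, f.coeff i * (N : ℤ) ^ i|)
  have h4 : (0 : ℤ) ≤ (N : ℤ) ^ f.natDegree := by positivity
  rw [h1]
  constructor <;> linarith [h3.1, h3.2]

lemma aux_main (f : ℤ[X]) (hf : f.Monic) (e : ℕ) (he : 1 ≤ e) (hdeg : f.natDegree = e + 1)
    (hsep : (f.map (Int.castRingHom ℂ)).Separable) (c : ℤ) (hc : c ≠ 0) (C2 : ℕ) :
    ∃ Γ : ℕ, ∀ (N k : ℕ) (y : ℤ), 26 ≤ k → Γ ≤ N →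
      f.eval (N : ℤ) ^ (16 * (e + 1) * k) ∣ c ^ (16 * (e + 1) * k) * f.eval y →
      f.eval (N : ℤ) ∣ c * (y - N) →
      |y| ≤ (C2 : ℤ) ^ k * (N : ℤ) ^ (16 * (e + 1) * k + 16 * (e + 1)) → False := by
  obtain ⟨B0, hB, hB0⟩ := aux_powmod f hf
  obtain ⟨Γ1, hΓ1⟩ := aux_growth f hf
  set D := e + 1 with hD
  set q := 33 * D * D with hq
  set c' := c.natAbs with hc'
  have hc1 : 1 ≤ c' := Int.natAbs_pos.2 hc
  set Γ2 : ℕ := 2 ^ (16 * D) * c' ^ (16 * D) * 4 ^ q * (2 ^ (2 * q + 2) * (2 * B0) ^ (q + 1)) ^ (8 * D) *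
    (1 + C2) with hΓ2
  refine ⟨Γ1 + Γ2 + 1, fun N k y hk hN h1 h2 h3 => ?_⟩
  set r := 16 * D * k with hr
  set b := D * k * (8 * e + 1) with hb
  set a := b + (16 * D * k + 16 * D) with ha
  set J := 2 * D * k + 17 * D + 1 with hJ
  have hD2 : 2 ≤ D := by omega
  have n2 : a + b + 2 = r * D + (2 * D * k + 16 * D + 2) := by
    rw [ha, hb, hr, hD]; ring
  have hek : k ≤ e * k := Nat.le_mul_of_pos_left k he
  have n4 : b < r * (D - 1) := by
    rw [hD, Nat.add_sub_cancel, hr, hb, show 16 * D * k * e = D * k * (16 * e) by ring]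
    apply Nat.mul_lt_mul_of_pos_left (by omega)
    positivity
  have n5 : a < r * D := by
    rw [ha, hb, hr, show D * k * (8 * e + 1) + (16 * D * k + 16 * D) = D * (8 * (e * k) + 17 * k + 16) by ring,
      show 16 * D * k * D = D * (16 * (e * k) + 16 * k) by rw [hD]; ring]
    apply Nat.mul_lt_mul_of_pos_left (by omega)
    positivity
  have n6 : a + b < (r - 1) * D + J := by
    have : (r - 1) * D = r * D - D := by rw [Nat.sub_mul, one_mul]
    have : D ≤ r * D := Nat.le_mul_of_pos_left D (by positivity)
    omega
  have n7 : a + D * k ≤ D * (r - J) := by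
    have : r - J = 14 * (e * k) + 14 * k - 17 * e - 18 := by
      rw [hr, hJ, hD, show 16 * (e + 1) * k = 16 * (e * k) + 16 * k by ring,
        show 2 * (e + 1) * k = 2 * (e * k) + 2 * k by ring]
      omega
    rw [this, ha, hb, show D * k * (8 * e + 1) + (16 * D * k + 16 * D) + D * k = D * (8 * (e * k) + 18 * k + 16) by ring]
    apply Nat.mul_le_mul_left
    have : 26 * e ≤ e * k := by rw [mul_comm]; exact Nat.mul_le_mul_left e hk
    omega
  have n8 : a ≤ q * k := by
    have : a = 8 * (D * (e * k)) + 17 * (D * k) + 16 * D := by rw [ha, hb]; ring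
    have h' : q * k = 33 * (D * (e * k)) + 33 * (D * k) := by rw [hq]; nth_rewrite 2 [hD]; ring
    have : D ≤ D * k := Nat.le_mul_of_pos_right D (by omega)
    omega
  obtain ⟨A, B, hAB, hA, hBd, hAc, hBc, hdvd⟩ := aux_poly f hf B0 hB hB0 a b r (8 * D) (by omega)
    (by positivity) (by rw [hdeg]; omega) (by rw [hdeg]; omega) (by
      rw [hdeg, n2, Nat.add_sub_cancel_left, hr]
      nlinarith)
  set H : ℕ := ((a + b + 2) * (2 * B0) ^ (a + 1)) ^ (8 * D) with hH
  have hfN : (N : ℤ) ^ D ≤ 2 * f.eval (N : ℤ) := by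
    have := (hΓ1 N (by omega)).1
    rwa [hdeg] at this
  have hN0 : 1 ≤ N := by omega
  have hN1 : (1 : ℤ) ≤ N := by exact_mod_cast hN0
  have hND : (1 : ℤ) ≤ (N : ℤ) ^ D := one_le_pow₀ hN1
  have hfpos : 1 ≤ f.eval (N : ℤ) := by omega
  obtain ⟨j, hjJ, hj⟩ := aux_nonvanish f hf hsep A B a b r J hAB hA hBd hdvd N y (by omega)
    (by rw [hdeg]; exact n4) (by rw [hdeg]; exact n5) (by rw [hdeg]; exact n6)
  have hdv := aux_arith f A B r j hdvd N y c h1 h2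
  set F := (hasseDeriv j A).eval (N : ℤ) - y * (hasseDeriv j B).eval (N : ℤ) with hF
  have hle : f.eval (N : ℤ) ^ (r - J) ≤ (c' : ℤ) ^ r * |F| := by
    have h5 := Int.le_of_dvd (abs_pos.2 (mul_ne_zero (pow_ne_zero r hc) hj)) ((dvd_abs _ _).2 hdv)
    rw [abs_mul, abs_pow, Int.abs_eq_natAbs c] at h5
    exact (pow_le_pow_right₀ hfpos (by omega)).trans h5
  have hFle : |F| ≤ (4 : ℤ) ^ a * H * (N : ℤ) ^ a * (1 + (C2 : ℤ) ^ k) := by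
    have hA1 := aux_eval_bound A a H j N hN0 hA hAc
    have hB1 := aux_eval_bound B b H j N hN0 hBd hBc
    have hyB : |y * (hasseDeriv j B).eval (N : ℤ)| ≤
        (C2 : ℤ) ^ k * (N : ℤ) ^ (16 * D * k + 16 * D) * ((4 : ℤ) ^ a * H * (N : ℤ) ^ b) := by
      rw [abs_mul]
      refine mul_le_mul h3 (hB1.trans ?_) (abs_nonneg _) (by positivity)
      gcongr
      · norm_num
      · omega
    calc |F| ≤ |(hasseDeriv j A).eval (N : ℤ)| + |y * (hasseDeriv j B).eval (N : ℤ)| := abs_sub _ _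
      _ ≤ _ := add_le_add hA1 hyB
      _ = _ := by rw [show (N:ℤ) ^ a = (N:ℤ) ^ b * (N : ℤ) ^ (16 * D * k + 16 * D) by rw [← pow_add]]; ring
  have hmain : (N : ℤ) ^ a * (N : ℤ) ^ k ≤ (N : ℤ) ^ a *
      (2 ^ r * (c' : ℤ) ^ r * (4 ^ a * H * (1 + (C2 : ℤ) ^ k))) := by
    calc (N : ℤ) ^ a * (N : ℤ) ^ k ≤ (N : ℤ) ^ (D * (r - J)) := by
          rw [← pow_add]
          apply pow_le_pow_right₀ hN1
          have : k ≤ D * k := Nat.le_mul_of_pos_left k (by omega)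
          omega
      _ = ((N : ℤ) ^ D) ^ (r - J) := pow_mul _ _ _
      _ ≤ (2 * f.eval (N : ℤ)) ^ (r - J) := by gcongr
      _ = 2 ^ (r - J) * f.eval (N : ℤ) ^ (r - J) := mul_pow _ _ _
      _ ≤ 2 ^ r * ((c' : ℤ) ^ r * |F|) := by
          refine mul_le_mul (pow_le_pow_right₀ (by norm_num) (Nat.sub_le _ _)) hle (by positivity) (by positivity)
      _ ≤ 2 ^ r * ((c' : ℤ) ^ r * ((4 : ℤ) ^ a * H * (N : ℤ) ^ a * (1 + (C2 : ℤ) ^ k))) := by gcongr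
      _ = _ := by ring
  have hmain2 := le_of_mul_le_mul_left hmain (by positivity)
  have hnat : N ^ k ≤ 2 ^ r * c' ^ r * (4 ^ a * H * (1 + C2 ^ k)) := by exact_mod_cast hmain2
  have hHle : H ≤ ((2 ^ (2 * q + 2) * (2 * B0) ^ (q + 1)) ^ (8 * D)) ^ k := by
    rw [hH, pow_right_comm]
    apply Nat.pow_le_pow_left
    rw [mul_pow (2 ^ (2 * q + 2))]
    apply Nat.mul_le_mul
    · rw [← pow_mul]
      refine (Nat.lt_two_pow_self).le.trans (Nat.pow_le_pow_right (by norm_num) ?_)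
      rw [show (2 * q + 2) * k = 2 * (q * k) + 2 * k by ring]
      omega
    · rw [← pow_mul]
      apply Nat.pow_le_pow_right (by omega)
      rw [show (q + 1) * k = q * k + k by ring]
      omega
  have hC2 : 1 + C2 ^ k ≤ (1 + C2) ^ k := by
    have := pow_add_pow_le (Nat.zero_le 1) (Nat.zero_le C2) (by omega : k ≠ 0)
    simpa using this
  have h4a : 4 ^ a ≤ (4 ^ q) ^ k := by
    rw [← pow_mul]; exact Nat.pow_le_pow_right (by norm_num) n8
  have hfin : N ^ k ≤ Γ2 ^ k := by
    calc N ^ k ≤ _ := hnat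
      _ ≤ 2 ^ r * c' ^ r * ((4 ^ q) ^ k * ((2 ^ (2 * q + 2) * (2 * B0) ^ (q + 1)) ^ (8 * D)) ^ k * (1 + C2) ^ k) := by
        gcongr
      _ = Γ2 ^ k := by
        rw [hΓ2, hr, pow_mul 2 (16 * D) k, pow_mul c' (16 * D) k]
        generalize 2 ^ (16 * D) = u1
        generalize c' ^ (16 * D) = u2
        generalize 4 ^ q = u3
        generalize (2 ^ (2 * q + 2) * (2 * B0) ^ (q + 1)) ^ (8 * D) = u4
        generalize 1 + C2 = u5
        simp only [mul_pow]
        ring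
  have := lt_of_pow_lt_pow_left₀ k (Nat.zero_le _) (lt_of_le_of_lt hfin
    (Nat.pow_lt_pow_left (by omega : Γ2 < Γ2 + 1) (by omega)))
  omega

lemma aux_cop (x L z : ℤ) (k : ℕ) (h : x ∣ L ^ k) : IsCoprime x (1 + L * z) := by
  have h1 : IsCoprime L (1 + L * z) := ⟨-z, 1, by ring⟩
  exact (h1.pow_left (m := k)).of_isCoprime_of_dvd_left h

lemma aux_div (f g u v : ℤ[X]) (e : ℕ) (he : e ≠ 0) (R γ t : ℤ) (h : u * f + v * g = C R)
    (N y : ℤ) (m1 m2 r : ℕ) (hr : 1 ≤ r) (hm : r * m1 ≤ m2)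
    (hN : (f ^ e * g).eval N = γ * t ^ m1) (hy : (f ^ e * g).eval y = γ * t ^ m2)
    (hmod : R * (γ * t) ∣ y - N) : f.eval N ^ r ∣ (γ * R) ^ r * f.eval y := by
  have hfL : f.eval N ∣ (γ * t) ^ (m1 + 1) := by
    have h1 : f.eval N ∣ γ * t ^ m1 := by
      rw [← hN, eval_mul, eval_pow]
      exact (dvd_pow_self _ he).mul_right _
    refine h1.trans ?_
    rw [mul_pow]
    exact mul_dvd_mul (dvd_pow_self _ (by omega)) (pow_dvd_pow _ (by omega))
  obtain ⟨w, hw⟩ := hmod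
  obtain ⟨z, hz⟩ := (sub_dvd_eval_sub y N g)
  have hR : u.eval N * f.eval N + v.eval N * g.eval N = R := by
    have := congrArg (eval N) h
    simpa using this
  have hcop := aux_cop _ _ (v.eval N * w * z) _ hfL
  have h2 : f.eval N ^ (e * r) ∣ γ ^ r * (f.eval y ^ e * g.eval y) := by
    have h3 : f.eval N ^ e ∣ γ * t ^ m1 := by
      rw [← hN, eval_mul, eval_pow]; exact dvd_mul_right _ _
    have h4 := pow_dvd_pow_of_dvd h3 r
    rw [← pow_mul] at h4
    refine h4.trans ?_
    have h5 : f.eval y ^ e * g.eval y = γ * t ^ m2 := by rw [← hy, eval_mul, eval_pow]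
    rw [h5, mul_pow, ← pow_mul]
    apply mul_dvd_mul_left
    apply Dvd.dvd.mul_left
    exact pow_dvd_pow _ (by rw [mul_comm]; exact hm)
  obtain ⟨p, q, hpq⟩ := hcop
  -- Bezout for `f(N)` and `g(y)`
  have hbez : ∃ U V : ℤ, U * f.eval N + V * g.eval y = R := by
    refine ⟨p * R + q * u.eval N, q * v.eval N, ?_⟩
    rw [hw] at hz
    linear_combination R * hpq + q * hR + q * v.eval N * hz
  obtain ⟨U, V, hUV⟩ := hbez
  have hbez2 : ∃ W : ℤ, R ^ (e * r) = (U * f.eval N) ^ (e * r) + W * g.eval y := by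
    obtain ⟨W, hW⟩ := sub_dvd_pow_sub_pow R (U * f.eval N) (e * r)
    exact ⟨V * W, by rw [← hUV] at hW ⊢; linear_combination hW⟩
  obtain ⟨W, hW⟩ := hbez2
  have h6 : f.eval N ^ (e * r) ∣ γ ^ r * R ^ (e * r) * f.eval y ^ e := by
    rw [hW]
    have : γ ^ r * ((U * f.eval N) ^ (e * r) + W * g.eval y) * f.eval y ^ e =
      f.eval N ^ (e * r) * (γ ^ r * U ^ (e * r) * f.eval y ^ e) + (γ ^ r * (f.eval y ^ e * g.eval y)) * W := by
      rw [mul_pow]; ring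
    rw [this]
    exact dvd_add (dvd_mul_right _ _) (h2.mul_right _)
  have h7 : (f.eval N ^ r) ^ e ∣ ((γ * R) ^ r * f.eval y) ^ e := by
    rw [← pow_mul, mul_comm r e]
    refine h6.trans ?_
    rw [mul_pow, ← pow_mul, mul_pow, mul_comm r e]
    apply mul_dvd_mul_right
    apply mul_dvd_mul_right
    exact pow_dvd_pow _ (Nat.le_mul_of_pos_left r (by omega))
  exact (Int.pow_dvd_pow_iff he).1 h7

lemma aux_h (f u v : ℤ[X]) (D c L : ℤ) (k : ℕ) (h : u * f + v * derivative f = C D) (N y : ℤ)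
    (h1 : f.eval N ∣ c * f.eval y) (hL : f.eval N ∣ L ^ k) (hmod : D * L ∣ y - N) :
    f.eval N ∣ c * D * (y - N) := by
  obtain ⟨w, hw⟩ := hmod
  obtain ⟨z, hz⟩ := f.exists_mul_sq_add_linear_part_eq_eval_add N (y - N)
  have hR : u.eval N * f.eval N + v.eval N * (derivative f).eval N = D := by
    have := congrArg (eval N) h
    simpa using this
  have hcop := aux_cop _ _ (v.eval N * w * z) _ hL
  refine hcop.dvd_of_dvd_mul_right ?_
  obtain ⟨s, hs⟩ := h1
  rw [add_sub_cancel] at hz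
  refine ⟨v.eval N * s - c * v.eval N + c * (y - N) * u.eval N, ?_⟩
  linear_combination v.eval N * hs + v.eval N * c * hz - c * (y - N) * hR - c * v.eval N * z * (y - N) * hw

lemma aux_int (Q : ℤ[X]) (hQ : Q.Monic) (hQd : 1 ≤ Q.natDegree) (γ t : ℤ) (hγ : γ ≠ 0)
    (E : Set ℕ) (hE : E.Infinite) (hEQ : ∀ x ∈ E, ∃ m : ℕ, Q.eval (x : ℤ) = γ * t ^ m)
    (f : ℤ[X]) (hf : f.Monic) (hfd : 2 ≤ f.natDegree) (hfQ : f ∣ Q) (u v : ℤ[X]) (D : ℤ) (hD : D ≠ 0)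
    (huv : u * f + v * derivative f = C D) (c M : ℤ) (hc : c ≠ 0) (hM : M ≠ 0)
    (hdiv : ∀ (N y : ℤ) (m1 m2 r : ℕ), 1 ≤ r → r * m1 ≤ m2 → Q.eval N = γ * t ^ m1 →
      Q.eval y = γ * t ^ m2 → M ∣ y - N → f.eval N ^ r ∣ c ^ r * f.eval y) : False := by
  obtain ⟨e, he⟩ : ∃ e, f.natDegree = e + 1 := ⟨f.natDegree - 1, by omega⟩
  have hsep : (f.map (Int.castRingHom ℂ)).Separable := by
    have h1 := congrArg (Polynomial.map (Int.castRingHom ℂ)) huv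
    simp only [Polynomial.map_add, Polynomial.map_mul, map_C] at h1
    have hD' : (Int.castRingHom ℂ) D ≠ 0 := by simpa using hD
    refine ⟨C ((Int.castRingHom ℂ) D)⁻¹ * u.map (Int.castRingHom ℂ),
      C ((Int.castRingHom ℂ) D)⁻¹ * v.map (Int.castRingHom ℂ), ?_⟩
    rw [mul_assoc, mul_assoc, ← mul_add, derivative_map, h1, ← C_mul, inv_mul_cancel₀ hD', C_1]
  obtain ⟨Γ0, hΓ0⟩ := aux_growth Q hQ
  have hlow : ∀ x : ℕ, Γ0 ≤ x → (x : ℤ) ≤ 2 * Q.eval (x : ℤ) := by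
    intro x hx
    refine le_trans ?_ (hΓ0 x hx).1
    exact_mod_cast Nat.le_self_pow (by omega) x
  -- large x gives large m
  have hmlarge : ∀ B : ℕ, ∃ X0 : ℕ, ∀ x : ℕ, X0 ≤ x → ∀ m : ℕ, Q.eval (x : ℤ) = γ * t ^ m → B ≤ m := by
    intro B
    refine ⟨Γ0 + 2 * (γ.natAbs * (t.natAbs + 1) ^ B) + 1, fun x hx m hm => ?_⟩
    by_contra! hlt
    have h1 := hlow x (by omega)
    have h2 : Q.eval (x : ℤ) ≤ ((γ.natAbs * (t.natAbs + 1) ^ B : ℕ) : ℤ) := by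
      rw [hm]
      refine (le_abs_self _).trans ?_
      rw [abs_mul, abs_pow, Int.abs_eq_natAbs, Int.abs_eq_natAbs]
      have : γ.natAbs * t.natAbs ^ m ≤ γ.natAbs * (t.natAbs + 1) ^ B := by
        apply Nat.mul_le_mul_left
        exact (Nat.pow_le_pow_left (by omega) m).trans (Nat.pow_le_pow_right (by omega) hlt.le)
      exact_mod_cast this
    have h3 : (x : ℤ) ≤ ((2 * (γ.natAbs * (t.natAbs + 1) ^ B) : ℕ) : ℤ) := by
      push_cast at h2 ⊢; linarith
    have h4 : x ≤ 2 * (γ.natAbs * (t.natAbs + 1) ^ B) := by exact_mod_cast h3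
    omega
  -- t is nonzero
  have ht : t ≠ 0 := by
    obtain ⟨X0, hX0⟩ := hmlarge 1
    obtain ⟨x, hxE, hx⟩ := hE.exists_gt (X0 + Γ0)
    obtain ⟨m, hm⟩ := hEQ x hxE
    have h1 := hX0 x (by omega) m hm
    rintro rfl
    rw [zero_pow (by omega), mul_zero] at hm
    have := hlow x (by omega)
    omega
  have hL : γ * t ≠ 0 := mul_ne_zero hγ ht
  -- pigeonhole
  set m0 : ℕ := (M * (D * (γ * t))).natAbs with hm0
  have hm0pos : 0 < m0 := Int.natAbs_pos.2 (mul_ne_zero hM (mul_ne_zero hD hL))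
  obtain ⟨i, hi⟩ : ∃ i : ℕ, (E ∩ {x | x % m0 = i}).Infinite := by
    by_contra! hcon
    apply hE
    have : E ⊆ ⋃ i ∈ Finset.range m0, (E ∩ {x | x % m0 = i}) := by
      intro x hx
      simp only [Set.mem_iUnion]
      exact ⟨x % m0, Finset.mem_range.2 (Nat.mod_lt _ hm0pos), hx, rfl⟩
    refine Set.Finite.subset ?_ this
    exact Set.Finite.biUnion (Finset.finite_toSet _) (fun i _ => Set.not_infinite.1 (by simpa using hcon i))
  obtain ⟨K, hK⟩ : ∃ K : ℕ, K = 16 * (e + 1) := ⟨_, rfl⟩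
  obtain ⟨C2, hC2⟩ : ∃ C2 : ℕ, C2 = 2 * γ.natAbs * 2 ^ (2 * K) := ⟨_, rfl⟩
  obtain ⟨Γ, hΓ⟩ := aux_main f hf e (by omega) he hsep (c * D) (mul_ne_zero hc hD) C2
  rw [← hK] at hΓ
  obtain ⟨X1, hX1⟩ := hmlarge 1
  obtain ⟨N, ⟨hNE, hNi⟩, hN⟩ := hi.exists_gt (Γ + Γ0 + X1)
  obtain ⟨m1, hm1⟩ := hEQ N hNE
  have hm1pos := hX1 N (by omega) m1 hm1
  obtain ⟨X2, hX2⟩ := hmlarge (26 * (K * m1))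
  obtain ⟨y, ⟨hyE, hyi⟩, hy⟩ := hi.exists_gt (Γ0 + X2)
  obtain ⟨m2, hm2⟩ := hEQ y hyE
  have hm2l := hX2 y (by omega) m2 hm2
  have hKm : 0 < K * m1 := Nat.mul_pos (by omega) hm1pos
  obtain ⟨k, hk⟩ : ∃ k : ℕ, k = m2 / (K * m1) := ⟨_, rfl⟩
  have hk26 : 26 ≤ k := hk ▸ (Nat.le_div_iff_mul_le hKm).2 hm2l
  have hkm : k * (K * m1) ≤ m2 := hk ▸ Nat.div_mul_le_self _ _
  have hkm2 : m2 < (k + 1) * (K * m1) := by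
    rw [mul_comm, hk]; exact Nat.lt_mul_div_succ m2 hKm
  have hmod : (M * (D * (γ * t))) ∣ (y : ℤ) - N := by
    rw [← Int.natAbs_dvd, ← hm0]
    exact (Nat.modEq_iff_dvd).1 (by rw [Set.mem_ofPred_eq] at hNi hyi; unfold Nat.ModEq; omega)
  have hMd : M ∣ (y : ℤ) - N := (dvd_mul_right _ _).trans hmod
  have hDd : D * (γ * t) ∣ (y : ℤ) - N := (dvd_mul_left _ _).trans hmod
  refine hΓ N k y hk26 (by omega) ?_ ?_ ?_
  · have h1 := hdiv N y m1 m2 (K * k) (Nat.mul_pos (by omega) (by omega)) (by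
      refine le_trans (le_of_eq ?_) hkm; ring) hm1 hm2 hMd
    refine h1.trans ?_
    apply mul_dvd_mul_right
    exact pow_dvd_pow_of_dvd (dvd_mul_right _ _) _
  · have h1 := hdiv N y m1 m2 1 le_rfl (by
      rw [one_mul]
      exact (Nat.le_mul_of_pos_left m1 (by omega : 0 < 26 * K)).trans (by rw [mul_assoc]; exact hm2l)) hm1 hm2 hMd
    rw [pow_one, pow_one] at h1
    refine aux_h f u v D c (γ * t) (m1 + 1) huv N y h1 ?_ hDd
    refine (eval_dvd hfQ).trans ?_
    rw [hm1, mul_pow]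
    exact mul_dvd_mul (dvd_pow_self _ (by omega)) (pow_dvd_pow _ (by omega))
  · have hd0 : Q.natDegree ≠ 0 := by omega
    set d := Q.natDegree with hd
    have g1 := (hΓ0 y (by omega)).1
    have g2 := (hΓ0 N (by omega)).2
    have q1 : Q.eval (y : ℤ) ≤ γ.natAbs * (t.natAbs : ℤ) ^ m2 := by
      rw [hm2, ← Int.abs_eq_natAbs, ← Int.abs_eq_natAbs, ← abs_pow, ← abs_mul]; exact le_abs_self _
    have hγ1 : (1 : ℤ) ≤ γ.natAbs := by exact_mod_cast Int.natAbs_pos.2 hγ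
    have ht1 : (1 : ℤ) ≤ t.natAbs := by exact_mod_cast Int.natAbs_pos.2 ht
    have q2 : (t.natAbs : ℤ) ^ m1 ≤ 2 * (N : ℤ) ^ d := by
      refine le_trans ?_ g2
      have hQN : (N : ℤ) ≤ 2 * Q.eval (N : ℤ) := hlow N (by omega)
      have : Q.eval (N : ℤ) = γ.natAbs * (t.natAbs : ℤ) ^ m1 := by
        rw [← abs_of_nonneg (by omega : 0 ≤ Q.eval (N : ℤ)), hm1, abs_mul, abs_pow,
          Int.abs_eq_natAbs, Int.abs_eq_natAbs]
      rw [this]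
      have : (0 : ℤ) ≤ (t.natAbs : ℤ) ^ m1 := by positivity
      nlinarith
    have hN1 : (1 : ℤ) ≤ N := by exact_mod_cast (by omega : 1 ≤ N)
    rw [Nat.abs_cast]
    have q3 : (y : ℤ) ^ d ≤ ((C2 : ℤ) ^ k * (N : ℤ) ^ (K * k + K)) ^ d := by
      calc (y : ℤ) ^ d ≤ 2 * (γ.natAbs * (t.natAbs : ℤ) ^ m2) := by linarith
        _ ≤ 2 * (γ.natAbs * (t.natAbs : ℤ) ^ (m1 * (K * k + K))) := by
          gcongr
          refine hkm2.le.trans (le_of_eq ?_); ring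
        _ ≤ 2 * (γ.natAbs * (2 * (N : ℤ) ^ d) ^ (K * k + K)) := by
          rw [pow_mul]; gcongr
        _ = (2 * γ.natAbs * 2 ^ (K * k + K)) * ((N : ℤ) ^ (K * k + K)) ^ d := by
          rw [mul_pow, ← pow_mul, ← pow_mul, mul_comm d]; ring
        _ ≤ ((C2 : ℤ) ^ k) ^ d * ((N : ℤ) ^ (K * k + K)) ^ d := by
          gcongr
          have c1 : (2 * γ.natAbs * 2 ^ (K * k + K) : ℤ) ≤ (C2 : ℤ) ^ k := by
            rw [hC2]; simp only [Nat.cast_mul, Nat.cast_pow, Nat.cast_ofNat]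
            rw [mul_pow, ← pow_mul]
            have hge : (1 : ℤ) ≤ 2 * γ.natAbs := by linarith
            apply mul_le_mul _ _ (by positivity) (by positivity)
            · exact le_self_pow₀ hge (by omega)
            · apply pow_le_pow_right₀ (by norm_num)
              have : K ≤ K * k := Nat.le_mul_of_pos_right K (by omega)
              linarith
          have c2 : (1 : ℤ) ≤ (C2 : ℤ) ^ k := by
            refine le_trans ?_ c1
            have : (1 : ℤ) ≤ 2 ^ (K * k + K) := one_le_pow₀ (by norm_num)
            nlinarith
          exact c1.trans (le_self_pow₀ c2 hd0)
        _ = _ := by rw [mul_pow]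
    exact le_of_pow_le_pow_left₀ hd0 (by positivity) q3

lemma aux_clear (f g : ℤ[X])
    (h : IsCoprime (f.map (algebraMap ℤ ℚ)) (g.map (algebraMap ℤ ℚ))) :
    ∃ (u v : ℤ[X]) (R : ℤ), R ≠ 0 ∧ u * f + v * g = C R := by
  obtain ⟨a, b, hab⟩ := h
  obtain ⟨b1, h1⟩ := IsLocalization.integerNormalization_map_to_map (nonZeroDivisors ℤ) a
  obtain ⟨b2, h2⟩ := IsLocalization.integerNormalization_map_to_map (nonZeroDivisors ℤ) b
  set A := IsLocalization.integerNormalization (nonZeroDivisors ℤ) a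
  set B := IsLocalization.integerNormalization (nonZeroDivisors ℤ) b
  have hb1 : (b1 : ℤ) ≠ 0 := nonZeroDivisors.ne_zero b1.2
  have hb2 : (b2 : ℤ) ≠ 0 := nonZeroDivisors.ne_zero b2.2
  refine ⟨C (b2 : ℤ) * A, C (b1 : ℤ) * B, b1 * b2, mul_ne_zero hb1 hb2, ?_⟩
  apply Polynomial.map_injective (algebraMap ℤ ℚ) (algebraMap ℤ ℚ).injective_int
  have k1 : A.map (algebraMap ℤ ℚ) = C (algebraMap ℤ ℚ b1) * a := by
    rw [h1, Algebra.smul_def]; rfl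
  have k2 : B.map (algebraMap ℤ ℚ) = C (algebraMap ℤ ℚ b2) * b := by
    rw [h2, Algebra.smul_def]; rfl
  simp only [Polynomial.map_add, Polynomial.map_mul, map_C, k1, k2, map_mul]
  linear_combination C (algebraMap ℤ ℚ b1) * C (algebraMap ℤ ℚ b2) * hab

lemma aux_minpoly_map (a : AlgebraicClosure ℚ) (ha : IsIntegral ℤ a) :
    (minpoly ℤ a).map (algebraMap ℤ ℚ) = minpoly ℚ a :=
  (minpoly.isIntegrallyClosed_eq_field_fractions' ℚ ha).symm

lemma aux_cop2 (a : AlgebraicClosure ℚ) (ha : IsIntegral ℤ a) (g : ℤ[X])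
    (h : aeval a g ≠ 0) :
    IsCoprime ((minpoly ℤ a).map (algebraMap ℤ ℚ)) (g.map (algebraMap ℤ ℚ)) := by
  rw [aux_minpoly_map a ha, (minpoly.irreducible ha.tower_top).coprime_iff_not_dvd]
  intro hd
  apply h
  have := (minpoly.dvd_iff).1 hd
  rwa [aeval_map_algebraMap] at this

lemma aux_factor (Q : ℤ[X]) (hQ : Q.Monic) (a : AlgebraicClosure ℚ) (ha : IsIntegral ℤ a)
    (hr : aeval a Q = 0) : ∃ (e : ℕ) (g u v : ℤ[X]) (R : ℤ), e ≠ 0 ∧ R ≠ 0 ∧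
      Q = minpoly ℤ a ^ e * g ∧ u * minpoly ℤ a + v * g = C R := by
  have hdvd : minpoly ℤ a ∣ Q := minpoly.isIntegrallyClosed_dvd ha hr
  have hfin : FiniteMultiplicity (minpoly ℤ a) Q :=
    finiteMultiplicity_of_degree_pos_of_monic (minpoly.degree_pos ha) (minpoly.monic ha) hQ.ne_zero
  obtain ⟨g, hg, hng⟩ := hfin.exists_eq_pow_mul_and_not_dvd
  have hag : aeval a g ≠ 0 := fun h0 => hng (minpoly.isIntegrallyClosed_dvd ha h0)
  obtain ⟨u, v, R, hR, huv⟩ := aux_clear _ _ (aux_cop2 a ha g hag)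
  refine ⟨_, g, u, v, R, ?_, hR, hg, huv⟩
  intro h0
  rw [h0, pow_zero, one_mul] at hg
  exact hng (hg ▸ hdvd)

lemma aux_T1 (Q : ℤ[X]) (hQ : Q.Monic) (hQd : 1 ≤ Q.natDegree) (γ t : ℤ) (hγ : γ ≠ 0) (ht : t ≠ 0)
    (E : Set ℕ) (hE : E.Infinite) (hEQ : ∀ x ∈ E, ∃ m : ℕ, Q.eval (x : ℤ) = γ * t ^ m)
    (a b : AlgebraicClosure ℚ) (ha : aeval a Q = 0) (hb : aeval b Q = 0) : a = b := by
  by_contra hab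
  have ia : IsIntegral ℤ a := ⟨Q, hQ, ha⟩
  have ib : IsIntegral ℤ b := ⟨Q, hQ, hb⟩
  obtain ⟨e1, g1, u1, v1, R1, he1, hR1, hQ1, huv1⟩ := aux_factor Q hQ a ia ha
  obtain ⟨e2, g2, u2, v2, R2, he2, hR2, hQ2, huv2⟩ := aux_factor Q hQ b ib hb
  have hL : γ * t ≠ 0 := mul_ne_zero hγ ht
  have mina := minpoly.monic ia
  have minb := minpoly.monic ib
  have sa : (minpoly ℚ a).Separable := (minpoly.irreducible ia.tower_top).separable
  have sb : (minpoly ℚ b).Separable := (minpoly.irreducible ib.tower_top).separable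
  have da := minpoly.natDegree_pos ia
  have db := minpoly.natDegree_pos ib
  by_cases hab2 : aeval a (minpoly ℤ b) = 0
  · have hdeg : 2 ≤ (minpoly ℤ b).natDegree := by
      by_contra hlt
      have h1 : (minpoly ℤ b).natDegree = 1 := by omega
      have hX := minb.eq_X_add_C h1
      have hb0 := minpoly.aeval ℤ b
      rw [hX] at hab2 hb0
      simp only [map_add, aeval_X, aeval_C] at hab2 hb0
      exact hab (add_right_cancel (hab2.trans hb0.symm))
    obtain ⟨u, v, D, hD, huv⟩ := aux_clear (minpoly ℤ b) (derivative (minpoly ℤ b)) (by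
      rw [← derivative_map, aux_minpoly_map b ib]; exact sb)
    refine aux_int Q hQ hQd γ t hγ E hE hEQ (minpoly ℤ b) minb hdeg
      (minpoly.isIntegrallyClosed_dvd ib hb) u v D hD huv (γ * R2) (R2 * (γ * t))
      (mul_ne_zero hγ hR2) (mul_ne_zero hR2 hL) ?_
    intro N y m1 m2 r hr hm hN hy hd
    exact aux_div _ g2 u2 v2 e2 he2 R2 γ t huv2 N y m1 m2 r hr hm (hQ2 ▸ hN) (hQ2 ▸ hy) hd
  · obtain ⟨u, v, D, hD, huv⟩ := aux_clear (minpoly ℤ a * minpoly ℤ b)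
      (derivative (minpoly ℤ a * minpoly ℤ b)) (by
        have hc := aux_cop2 a ia _ hab2
        rw [aux_minpoly_map a ia, aux_minpoly_map b ib] at hc
        rw [← derivative_map, Polynomial.map_mul, aux_minpoly_map a ia, aux_minpoly_map b ib]
        exact sa.mul sb hc)
    refine aux_int Q hQ hQd γ t hγ E hE hEQ (minpoly ℤ a * minpoly ℤ b) (mina.mul minb) ?_ ?_
      u v D hD huv ((γ * R1) * (γ * R2)) ((R1 * (γ * t)) * (R2 * (γ * t)))
      (mul_ne_zero (mul_ne_zero hγ hR1) (mul_ne_zero hγ hR2))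
      (mul_ne_zero (mul_ne_zero hR1 hL) (mul_ne_zero hR2 hL)) ?_
    · rw [mina.natDegree_mul minb]; omega
    · obtain ⟨h, hh⟩ : minpoly ℤ b ∣ Q := minpoly.isIntegrallyClosed_dvd ib hb
      have h0 : aeval a h = 0 := by
        rw [hh, map_mul] at ha
        exact (mul_eq_zero.1 ha).resolve_left hab2
      rw [hh, mul_comm]
      exact mul_dvd_mul_left _ (minpoly.isIntegrallyClosed_dvd ia h0)
    · intro N y m1 m2 r hr hm hN hy hd
      have d1 := aux_div _ g1 u1 v1 e1 he1 R1 γ t huv1 N y m1 m2 r hr hm (hQ1 ▸ hN) (hQ1 ▸ hy)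
        ((dvd_mul_right _ _).trans hd)
      have d2 := aux_div _ g2 u2 v2 e2 he2 R2 γ t huv2 N y m1 m2 r hr hm (hQ2 ▸ hN) (hQ2 ▸ hy)
        ((dvd_mul_left _ _).trans hd)
      have := mul_dvd_mul d1 d2
      rw [eval_mul, eval_mul, mul_pow, mul_pow]
      refine this.trans (dvd_of_eq ?_)
      ring

lemma aux_fin {F : Type*} [Field F] [CharZero F] (R : F[X]) (hd : 1 ≤ R.natDegree) (w : F) :
    {n : ℕ | R.eval (n : F) = w}.Finite := by
  have h0 : R - C w ≠ 0 := by
    intro h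
    have : R = C w := sub_eq_zero.1 h
    rw [this, natDegree_C] at hd
    omega
  have h1 : {x : F | (R - C w).IsRoot x}.Finite := finite_setOf_isRoot h0
  refine Set.Finite.subset (h1.preimage (f := fun n : ℕ => (n : F)) (Nat.cast_injective.injOn)) ?_
  intro n hn
  have hn' : R.eval (n : F) = w := hn
  change (R - C w).eval (n : F) = 0
  rw [eval_sub, eval_C, hn', sub_self]

lemma aux_T (R : ℚ[X]) (hd : 1 ≤ R.natDegree) (t : ℚ)
    (hinf : {n : ℕ | ∃ m : ℕ, R.eval (n : ℚ) = t ^ m}.Infinite)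
    (a b : AlgebraicClosure ℚ) (ha : aeval a R = 0) (hb : aeval b R = 0) : a = b := by
  have hR0 : R ≠ 0 := by rintro rfl; simp at hd
  -- exponents are unbounded
  have hunb : ∀ B : ℕ, ∃ n m : ℕ, B < m ∧ R.eval (n : ℚ) = t ^ m := by
    intro B
    by_contra! hcon
    apply hinf
    have hsub : {n : ℕ | ∃ m : ℕ, R.eval (n : ℚ) = t ^ m} ⊆
        ⋃ m ∈ Finset.range (B + 1), {n : ℕ | R.eval (n : ℚ) = t ^ m} := by
      rintro n ⟨m, hm⟩
      simp only [Set.mem_iUnion]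
      refine ⟨m, Finset.mem_range.2 ?_, hm⟩
      by_contra hlt
      exact hcon n m (by omega) hm
    exact Set.Finite.subset (Set.Finite.biUnion (Finset.finite_toSet _) (fun m _ => aux_fin R hd _)) hsub
  have ht : t ≠ 0 := by
    rintro rfl
    apply hinf
    refine Set.Finite.subset ((aux_fin R hd 0).union (aux_fin R hd 1)) ?_
    rintro n ⟨m, hm⟩
    rcases Nat.eq_zero_or_pos m with h | h
    · right; simpa [h] using hm
    · left; rw [zero_pow h.ne'] at hm; exact hm
  -- clear denominators
  obtain ⟨P, c, hc, hP, hl⟩ : ∃ (P : ℤ[X]) (c : ℤ), c ≠ 0 ∧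
      P.map (algebraMap ℤ ℚ) = C (c : ℚ) * R ∧ 0 < P.leadingCoeff := by
    obtain ⟨b1, h1⟩ := IsLocalization.integerNormalization_map_to_map (nonZeroDivisors ℤ) R
    set A := IsLocalization.integerNormalization (nonZeroDivisors ℤ) R
    have hb1 : (b1 : ℤ) ≠ 0 := nonZeroDivisors.ne_zero b1.2
    have k1 : A.map (algebraMap ℤ ℚ) = C ((b1 : ℤ) : ℚ) * R := by
      rw [h1, Algebra.smul_def]; rfl
    have hA : A ≠ 0 := by
      intro h0
      rw [h0, Polynomial.map_zero] at k1
      have := mul_ne_zero (C_ne_zero.2 (Int.cast_ne_zero.2 hb1 : ((b1 : ℤ) : ℚ) ≠ 0)) hR0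
      exact this k1.symm
    rcases lt_or_gt_of_ne (leadingCoeff_ne_zero.2 hA) with h | h
    · refine ⟨-A, -b1, neg_ne_zero.2 hb1, ?_, by rw [leadingCoeff_neg]; omega⟩
      rw [Polynomial.map_neg, k1]; simp
    · exact ⟨A, b1, hb1, k1, h⟩
  have hPd : P.natDegree = R.natDegree := by
    rw [← natDegree_map_eq_of_injective (algebraMap ℤ ℚ).injective_int P, hP,
      natDegree_C_mul (Int.cast_ne_zero.2 hc)]
  have hP0 : P ≠ 0 := by rintro rfl; simp at hl
  set l := P.leadingCoeff with hldef
  obtain ⟨Q, hQdef⟩ : ∃ Q, Q = integralNormalization P := ⟨_, rfl⟩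
  have hQ : Q.Monic := hQdef ▸ monic_integralNormalization hP0
  have hQd : Q.natDegree = R.natDegree := by
    rw [hQdef, natDegree_integralNormalization, hPd]
  obtain ⟨γ, hγdef⟩ : ∃ γ : ℤ, γ = l ^ (P.natDegree - 1) * c := ⟨_, rfl⟩
  have hγ : γ ≠ 0 := hγdef ▸ mul_ne_zero (pow_ne_zero _ hl.ne') hc
  have hval : ∀ n m : ℕ, R.eval (n : ℚ) = t ^ m →
      ((Q.eval (l * n : ℤ) : ℤ) : ℚ) = γ * t ^ m := by
    intro n m hnm
    have h1 := integralNormalization_eval₂_leadingCoeff_mul (p := P) (by omega)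
      (RingHom.id ℤ) (n : ℤ)
    rw [RingHom.id_apply] at h1
    have h2 : Q.eval (l * n : ℤ) = l ^ (P.natDegree - 1) * P.eval (n : ℤ) := by
      rw [hQdef]; exact h1
    have h3 : ((P.eval (n : ℤ) : ℤ) : ℚ) = c * R.eval (n : ℚ) := by
      have := congrArg (eval (n : ℚ)) hP
      rw [eval_mul, eval_C] at this
      rw [← this]
      have h4 := eval_intCast_map (algebraMap ℤ ℚ) P (n : ℤ)
      simpa using h4.symm
    rw [h2, Int.cast_mul, h3, hnm, hγdef]; push_cast; ring
  -- `t` is an integer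
  have hden : t.den = 1 := by
    by_contra hne
    have h2 : 2 ≤ t.den := by have := t.den_pos; omega
    obtain ⟨n, m, hm, hnm⟩ := hunb γ.natAbs
    have h1 := hval n m hnm
    have h3 : Q.eval (l * n : ℤ) * (t.den : ℤ) ^ m = γ * t.num ^ m := by
      have hdq : ((t.den : ℤ) : ℚ) ≠ 0 := by exact_mod_cast t.den_nz
      have h4 : t * (t.den : ℚ) = t.num := Rat.mul_den_eq_num t
      have : ((Q.eval (l * n : ℤ) * (t.den : ℤ) ^ m : ℤ) : ℚ) = ((γ * t.num ^ m : ℤ) : ℚ) := by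
        push_cast
        push_cast at h1
        rw [h1, ← h4]; ring
      exact_mod_cast this
    have h4 : (t.den : ℤ) ^ m ∣ γ * t.num ^ m := ⟨_, by rw [← h3]; ring⟩
    have hcop : IsCoprime ((t.den : ℤ) ^ m) (t.num ^ m) := by
      apply IsCoprime.pow
      rw [Int.isCoprime_iff_gcd_eq_one]
      have := t.reduced
      rw [Int.gcd_comm]
      simpa [Int.gcd, Nat.Coprime] using this
    have h5 := hcop.dvd_of_dvd_mul_right h4
    have h6 := Nat.le_of_dvd (Int.natAbs_pos.2 hγ) (Int.natAbs_dvd_natAbs.2 h5)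
    rw [Int.natAbs_pow, Int.natAbs_natCast] at h6
    have h7 : m < 2 ^ m := Nat.lt_two_pow_self
    have h8 : 2 ^ m ≤ t.den ^ m := Nat.pow_le_pow_left h2 m
    omega
  have htn : t = (t.num : ℚ) := ((Rat.den_eq_one_iff t).1 hden).symm
  have hlN : ((l.natAbs : ℕ) : ℤ) = l := Int.natAbs_of_nonneg hl.le
  have hres := aux_T1 Q hQ (hQd ▸ hd) γ t.num hγ (Rat.num_ne_zero.2 ht)
    ((fun n => l.natAbs * n) '' {n : ℕ | ∃ m : ℕ, R.eval (n : ℚ) = t ^ m})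
    (hinf.image (by
      intro x _ y _ hxy
      exact Nat.eq_of_mul_eq_mul_left (Int.natAbs_pos.2 hl.ne') hxy))
    (by
      rintro _ ⟨n, ⟨m, hm⟩, rfl⟩
      refine ⟨m, ?_⟩
      have h1 := hval n m hm
      rw [htn] at h1
      have h2 : Q.eval (l * n : ℤ) = γ * t.num ^ m := by exact_mod_cast h1
      rw [← h2]
      dsimp only
      rw [Nat.cast_mul, hlN])
    (a * algebraMap ℤ _ l) (b * algebraMap ℤ _ l)
  have hroot : ∀ z : AlgebraicClosure ℚ, aeval z R = 0 → aeval (z * algebraMap ℤ _ l) Q = 0 := by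
    intro z hz
    have h1 : aeval z P = 0 := by
      rw [← aeval_map_algebraMap ℚ z P, hP, map_mul, hz, mul_zero]
    have h2 := integralNormalization_aeval_eq_zero h1 (fun x hx => by simpa using hx)
    rw [hQdef]
    rw [mul_comm]
    exact h2
  have h9 := hres (hroot a ha) (hroot b hb)
  have hl0 : algebraMap ℤ (AlgebraicClosure ℚ) l ≠ 0 := by simpa using hl.ne'
  exact mul_right_cancel₀ hl0 h9

lemma aux_alg : Algebra.IsAlgebraic ℚ (AlgebraicClosure ℚ) := by
  have h := AlgebraicClosure.isAlgebraic ℚ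
  have e : (AlgebraicClosure.instAlgebra ℚ : Algebra ℚ (AlgebraicClosure ℚ)) =
      DivisionRing.toRatAlgebra := Subsingleton.elim _ _
  rw [e] at h
  exact h

lemma aux_norm (K : IntermediateField ℚ (AlgebraicClosure ℚ)) [FiniteDimensional ℚ K] [IsGalois ℚ K]
    (P : K[X]) (hP : 1 ≤ P.natDegree) (s : K) : ∃ (R : ℚ[X]) (t : ℚ), 1 ≤ R.natDegree ∧
      (∀ z : AlgebraicClosure ℚ, aeval z P = 0 → aeval z R = 0) ∧
      ∀ n m : ℕ, P.eval (n : K) = s ^ m → R.eval (n : ℚ) = t ^ m := by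
  classical
  set R' : K[X] := ∏ σ : Gal(K/ℚ), P.map (σ : K →+* K) with hR'
  have hfix : ∀ τ : Gal(K/ℚ), R'.map (τ : K →+* K) = R' := by
    intro τ
    rw [hR', Polynomial.map_prod]
    refine Fintype.prod_equiv (Equiv.mulLeft τ) _ _ (fun σ => ?_)
    rw [Polynomial.map_map]
    rfl
  have hlift : R' ∈ lifts (algebraMap ℚ K) := by
    rw [lifts_iff_coeff_lifts]
    intro n
    rw [IsGalois.mem_range_algebraMap_iff_fixed]
    intro τ
    have := congrArg (fun p => coeff p n) (hfix τ)
    simpa [coeff_map] using this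
  obtain ⟨R, hR⟩ := hlift
  have hR : R.map (algebraMap ℚ K) = R' := hR
  have hP0 : P ≠ 0 := by rintro rfl; simp at hP
  have hR0 : R' ≠ 0 := by
    rw [hR', Finset.prod_ne_zero_iff]
    intro σ _
    exact (Polynomial.map_ne_zero_iff (σ : K →+* K).injective).2 hP0
  have hdvd : P ∣ R' := by
    have h1 : P = P.map ((1 : Gal(K/ℚ)) : K →+* K) := by
      ext i; rw [coeff_map]; rfl
    conv_lhs => rw [h1]
    exact Finset.dvd_prod_of_mem (fun σ : Gal(K/ℚ) => P.map (σ : K →+* K)) (Finset.mem_univ 1)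
  refine ⟨R, Algebra.norm ℚ s, ?_, ?_, ?_⟩
  · rw [← natDegree_map (algebraMap ℚ K) (p := R), hR]
    exact hP.trans (natDegree_le_of_dvd hdvd hR0)
  · intro z hz
    rw [← aeval_map_algebraMap K z R, hR]
    obtain ⟨w, hw⟩ := hdvd
    rw [hw, map_mul, hz, zero_mul]
  · intro n m h
    apply (algebraMap ℚ K).injective
    rw [map_pow, Algebra.norm_eq_prod_automorphisms, ← Finset.prod_pow]
    have h1 : algebraMap ℚ K (R.eval (n : ℚ)) = R'.eval (n : K) := by
      rw [← hR]
      have := eval_natCast_map (algebraMap ℚ K) R n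
      exact this.symm
    rw [h1, hR', eval_prod]
    refine Finset.prod_congr rfl (fun σ _ => ?_)
    rw [eval_natCast_map, h]
    exact map_pow σ s m

lemma aux_single (P : (AlgebraicClosure ℚ)[X]) (hP : 1 ≤ P.natDegree)
    (h : ∀ a b : AlgebraicClosure ℚ, P.IsRoot a → P.IsRoot b → a = b) :
    ∃ a b : AlgebraicClosure ℚ, P = C a * (X - C b) ^ P.natDegree := by
  have hP0 : P ≠ 0 := by rintro rfl; simp at hP
  have hsp : P.Splits := IsAlgClosed.splits P
  obtain ⟨b, hb⟩ := IsAlgClosed.exists_root P (by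
    intro h0; rw [natDegree_eq_zero_iff_degree_le_zero.2 h0.le] at hP; omega)
  refine ⟨P.leadingCoeff, b, ?_⟩
  have hrep : P.roots = Multiset.replicate P.natDegree b := by
    rw [Multiset.eq_replicate]
    refine ⟨hsp.natDegree_eq_card_roots.symm, fun x hx => h x b ((mem_roots hP0).1 hx) hb⟩
  conv_lhs => rw [hsp.eq_prod_roots, hrep]
  rw [Multiset.map_replicate, Multiset.prod_replicate]

/-- Let `s` be a nonzero algebraic number which is not a root of unity,
and let `P ∈ ℚ̄[x]` have degree `d ≥ 1`. If there are infinitely many pairs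
`(m, n) ∈ ℕ₀ × ℕ₀` with `P(n) = s^m`, then `P(x) = a·(x - b)^d` for some `a, b ∈ ℚ̄`. -/
theorem stmt5 (s : AlgebraicClosure ℚ) (hs : s ≠ 0)
    (hsnotunity : ¬ ∃ N : ℕ, 1 ≤ N ∧ s ^ N = 1)
    (P : Polynomial (AlgebraicClosure ℚ)) (d : ℕ) (hd : P.natDegree = d) (hd1 : 1 ≤ d)
    (hinf : {q : ℕ × ℕ | P.eval (q.2 : AlgebraicClosure ℚ) = s ^ q.1}.Infinite) :
    ∃ a b : AlgebraicClosure ℚ, P = C a * (X - C b) ^ d := by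
  subst hd
  apply aux_single P hd1
  have hinj : ∀ m m' : ℕ, s ^ m = s ^ m' → m = m' := by
    have key : ∀ m k : ℕ, s ^ m = s ^ (m + k) → k = 0 := by
      intro m k h
      by_contra hk
      apply hsnotunity
      refine ⟨k, by omega, ?_⟩
      rw [pow_add] at h
      exact (mul_left_cancel₀ (pow_ne_zero m hs) (by rw [mul_one]; exact h)).symm
    intro m m' h
    rcases le_total m m' with hle | hle
    · obtain ⟨k, rfl⟩ := Nat.exists_eq_add_of_le hle
      have := key m k h; omega
    · obtain ⟨k, rfl⟩ := Nat.exists_eq_add_of_le hle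
      have := key m' k h.symm; omega
  have hinf2 : {n : ℕ | ∃ m : ℕ, P.eval (n : AlgebraicClosure ℚ) = s ^ m}.Infinite := by
    have himg : (Prod.snd '' {q : ℕ × ℕ | P.eval (q.2 : AlgebraicClosure ℚ) = s ^ q.1}).Infinite := by
      apply hinf.image
      rintro ⟨m, n⟩ h1 ⟨m', n'⟩ h2 h3
      have h1' : P.eval (n : AlgebraicClosure ℚ) = s ^ m := h1
      have h2' : P.eval (n' : AlgebraicClosure ℚ) = s ^ m' := h2
      have h3' : n = n' := h3
      subst h3'
      rw [hinj m m' (h1'.symm.trans h2')]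
    refine himg.mono ?_
    rintro _ ⟨⟨m, n⟩, h, rfl⟩
    exact ⟨m, h⟩
  -- a finite Galois extension containing everything
  set S : Set (AlgebraicClosure ℚ) := insert s (P.coeffs : Set (AlgebraicClosure ℚ)) with hS
  have hSfin : S.Finite := (Finset.finite_toSet _).insert s
  set F := IntermediateField.adjoin ℚ S with hF
  have hnorm : Normal ℚ (AlgebraicClosure ℚ) := by
    have h1 := aux_alg
    exact @IsAlgClosure.normal ℚ (AlgebraicClosure ℚ) _ _ _ ⟨inferInstance, h1⟩
  have halg := aux_alg
  have : FiniteDimensional ℚ F := by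
    have : Finite S := hSfin
    exact IntermediateField.finiteDimensional_adjoin
      (fun x _ => (Algebra.IsAlgebraic.isAlgebraic x).isIntegral)
  set K := IntermediateField.normalClosure ℚ F (AlgebraicClosure ℚ) with hK
  have hSK : S ⊆ K := (IntermediateField.subset_adjoin ℚ S).trans F.le_normalClosure
  have : FiniteDimensional ℚ K := inferInstance
  have : Normal ℚ K := normalClosure.normal ℚ F (AlgebraicClosure ℚ)
  have : IsGalois ℚ K := ⟨⟩
  have hPlift : P ∈ lifts (algebraMap K (AlgebraicClosure ℚ)) := by
    rw [lifts_iff_coeff_lifts]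
    intro n
    by_cases hn : P.coeff n = 0
    · exact ⟨0, by rw [hn, map_zero]⟩
    · exact ⟨⟨P.coeff n, hSK (Set.mem_insert_of_mem _ (coeff_mem_coeffs hn))⟩, rfl⟩
  obtain ⟨PK, hPK⟩ := hPlift
  have hPK : PK.map (algebraMap K (AlgebraicClosure ℚ)) = P := hPK
  obtain ⟨R, t, hRd, hroot, heval⟩ := aux_norm K PK (by
    rw [← natDegree_map (algebraMap K (AlgebraicClosure ℚ)), hPK]; exact hd1)
    ⟨s, hSK (Set.mem_insert _ _)⟩
  have hrt : ∀ z : AlgebraicClosure ℚ, P.IsRoot z → aeval z R = 0 := by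
    intro z hz
    apply hroot
    rw [← eval_map_algebraMap, hPK]
    exact hz
  intro a b ha hb
  refine aux_T R hRd t (hinf2.mono ?_) a b (hrt a ha) (hrt b hb)
  rintro n ⟨m, hm⟩
  refine ⟨m, heval n m ?_⟩
  apply (algebraMap K (AlgebraicClosure ℚ)).injective
  rw [map_pow, ← eval_natCast_map, hPK, hm]
  rfl
end

section
/- Let p be a prime, k ∈ ℕ₀, a, b ∈ ℚ, and P ∈ ℚ[x] a polynomial of degree d ≥ 1. Then the set T of all n ∈ ℕ₀ for which there exists m ∈ ℕ₀ with P(n) = b + a·p^{mk} is a finite union of p-arithmetic sequences. -/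
/-- A `p`-arithmetic sequence of natural numbers: the set of `n ∈ ℕ₀` with
`(n : ℚ) = c·p^{k'j} + d` for some `j ∈ ℕ₀`, for fixed `c, d ∈ ℚ`, `k' ∈ ℕ₀`. -/
def IsPArithSeqNat (p : ℕ) (S : Set ℕ) : Prop :=
  ∃ (c d : ℚ) (k' : ℕ), S = {n : ℕ | ∃ j : ℕ, (n : ℚ) = c * (p : ℚ) ^ (k' * j) + d}

/-- A finite union of `p`-arithmetic sequences of natural numbers. -/
def IsFinUnionPArithNat (p : ℕ) (S : Set ℕ) : Prop :=
  ∃ (M : ℕ) (f : Fin M → Set ℕ), (∀ i, IsPArithSeqNat p (f i)) ∧ S = ⋃ i, f i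

open Polynomial

lemma coord_bound {d : ℕ} {R : Type*} [CommRing R] (b : Module.Basis (Fin d) ℤ R) (x : R) :
    ∃ C : ℕ, 1 ≤ C ∧ ∀ (j : ℕ) (l : Fin d), |b.repr (x ^ j) l| ≤ (C : ℤ) ^ (j + 1) := by
  classical
  set S : ℤ := ∑ i, ∑ l, |b.repr (x * b i) l| with hS
  set T : ℤ := ∑ l, |b.repr 1 l| with hT
  have hS0 : 0 ≤ S := Finset.sum_nonneg fun i _ => Finset.sum_nonneg fun l _ => abs_nonneg _
  have hT0 : 0 ≤ T := Finset.sum_nonneg fun i _ => abs_nonneg _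
  have key : ∀ j : ℕ, ∑ l, |b.repr (x ^ j) l| ≤ T * S ^ j := by
    intro j
    induction j with
    | zero => simp [hT]
    | succ j ih =>
      have h1 : ∀ l, b.repr (x ^ (j + 1)) l
          = ∑ i, b.repr (x ^ j) i * b.repr (x * b i) l := by
        intro l
        have : x ^ (j + 1) = ∑ i, b.repr (x ^ j) i • (x * b i) := by
          conv_lhs => rw [pow_succ', ← b.sum_repr (x ^ j), Finset.mul_sum]
          refine Finset.sum_congr rfl fun i _ => ?_
          rw [mul_smul_comm]
        rw [this]
        simp only [map_sum, map_smul, Finsupp.finsetSum_apply, Finsupp.smul_apply, smul_eq_mul]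
      calc ∑ l, |b.repr (x ^ (j + 1)) l|
          ≤ ∑ l, ∑ i, |b.repr (x ^ j) i| * |b.repr (x * b i) l| := by
            refine Finset.sum_le_sum fun l _ => ?_
            rw [h1]
            refine (Finset.abs_sum_le_sum_abs _ _).trans (le_of_eq ?_)
            exact Finset.sum_congr rfl fun i _ => abs_mul _ _
        _ = ∑ i, |b.repr (x ^ j) i| * ∑ l, |b.repr (x * b i) l| := by
            rw [Finset.sum_comm]
            exact Finset.sum_congr rfl fun i _ => (Finset.mul_sum _ _ _).symm
        _ ≤ ∑ i, |b.repr (x ^ j) i| * S := by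
            refine Finset.sum_le_sum fun i _ => ?_
            refine mul_le_mul_of_nonneg_left ?_ (abs_nonneg _)
            exact Finset.single_le_sum (f := fun i => ∑ l, |b.repr (x * b i) l|)
              (fun i _ => Finset.sum_nonneg fun l _ => abs_nonneg _) (Finset.mem_univ i)
        _ = (∑ i, |b.repr (x ^ j) i|) * S := by rw [Finset.sum_mul]
        _ ≤ T * S ^ j * S := mul_le_mul_of_nonneg_right ih hS0
        _ = T * S ^ (j + 1) := by ring
  clear_value S T
  refine ⟨(S + T + 1).toNat, by omega, fun j l => ?_⟩
  have h2 : ((S + T + 1).toNat : ℤ) = S + T + 1 := Int.toNat_of_nonneg (by omega)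
  rw [h2]
  calc |b.repr (x ^ j) l| ≤ ∑ l, |b.repr (x ^ j) l| :=
        Finset.single_le_sum (f := fun l => |b.repr (x ^ j) l|)
          (fun _ _ => abs_nonneg _) (Finset.mem_univ l)
    _ ≤ T * S ^ j := key j
    _ ≤ (S + T + 1) * (S + T + 1) ^ j := by
        refine mul_le_mul (by omega) (pow_le_pow_left₀ hS0 (by omega) j) (pow_nonneg hS0 _) (by omega)
    _ = (S + T + 1) ^ (j + 1) := (pow_succ' _ _).symm

attribute [local instance] Matrix.seminormedAddCommGroup in
/-- integer version of the Siegel lemma with integral exponent -/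
lemma siegel_int {α β : Type*} [Fintype α] [Fintype β] (A : Matrix α β ℤ) (s M : ℕ)
    (hm : 0 < Fintype.card α) (hn : Fintype.card α < Fintype.card β)
    (hs : Fintype.card α = s * (Fintype.card β - Fintype.card α))
    (hM1 : 1 ≤ M) (hM : ∀ i j, |A i j| ≤ M) :
    ∃ t : β → ℤ, t ≠ 0 ∧ A.mulVec t = 0 ∧ ∀ j, |t j| ≤ ((Fintype.card β * M) ^ s : ℕ) := by
  obtain ⟨t, ht0, ht, hb⟩ := Int.Matrix.exists_ne_zero_int_vec_norm_le A hn hm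
  refine ⟨t, ht0, ht, fun j => ?_⟩
  have hn' : (0 : ℝ) < (Fintype.card β : ℝ) - Fintype.card α := by
    rw [sub_pos]; exact_mod_cast hn
  have he : ((Fintype.card α : ℝ) / (Fintype.card β - Fintype.card α)) = (s : ℝ) := by
    rw [div_eq_iff hn'.ne']
    rw [← Nat.cast_sub hn.le]
    exact_mod_cast hs
  rw [he, Real.rpow_natCast] at hb
  have hA : ‖A‖ ≤ M := by
    rw [Matrix.norm_le_iff (by positivity)]
    intro i j
    rw [Int.norm_eq_abs]
    exact_mod_cast hM i j
  have h1 : ‖t j‖ ≤ ((Fintype.card β : ℝ) * M) ^ s := by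
    refine (norm_le_pi_norm t j).trans (hb.trans ?_)
    have : max 1 ‖A‖ ≤ (M : ℝ) := max_le (by exact_mod_cast hM1) hA
    gcongr
  rw [Int.norm_eq_abs] at h1
  exact_mod_cast h1

lemma dvd_of_hasse {R : Type*} [CommRing R] (F : R[X]) (x : R) (E : ℕ)
    (h : ∀ k < E, (hasseDeriv k F).eval x = 0) : (X - C x) ^ E ∣ F := by
  rw [X_sub_C_pow_dvd_iff, X_pow_dvd_iff]
  intro k hk
  have := h k hk
  rwa [← taylor_coeff] at this

lemma hasse_dvd {R : Type*} [CommRing R] (F : R[X]) (x n : R) (E k : ℕ)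
    (h : (X - C x) ^ E ∣ F) : (n - x) ^ (E - k) ∣ (hasseDeriv k F).eval n := by
  obtain ⟨G, rfl⟩ := h
  rw [← taylor_coeff, taylor_mul, coeff_mul]
  refine Finset.dvd_sum fun ij hij => ?_
  refine Dvd.dvd.mul_right ?_ _
  have : taylor n ((X - C x) ^ E) = (X + C (n - x)) ^ E := by
    rw [taylor_pow]; congr 1; simp [taylor_apply]; ring
  rw [this, coeff_X_add_C_pow]
  refine Dvd.dvd.mul_right (pow_dvd_pow _ ?_) _
  have := Finset.HasAntidiagonal.mem_antidiagonal.1 hij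
  omega

lemma aux_exists (g : ℤ[X]) (hg : g.Monic) (hd : 2 ≤ g.natDegree) :
    ∃ K : ℕ, 1 ≤ K ∧ ∀ e : ℕ, 1 ≤ e → ∃ A B : ℤ[X], ¬ (A = 0 ∧ B = 0) ∧
      A.degree < ((8 * g.natDegree * e + 9 * e : ℕ) : WithBot ℕ) ∧
      B.degree < ((8 * g.natDegree * e - 7 * e : ℕ) : WithBot ℕ) ∧
      (∀ i, |A.coeff i| ≤ (K : ℤ) ^ e) ∧ (∀ i, |B.coeff i| ≤ (K : ℤ) ^ e) ∧
      (X - C (AdjoinRoot.root g)) ^ (16 * e) ∣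
        A.map (algebraMap ℤ (AdjoinRoot g)) +
          C (AdjoinRoot.root g) * B.map (algebraMap ℤ (AdjoinRoot g)) := by
  classical
  set d := g.natDegree with hdd
  set x := AdjoinRoot.root g with hx
  let b : Module.Basis (Fin d) ℤ (AdjoinRoot g) := (AdjoinRoot.powerBasis' hg).basis
  obtain ⟨c, hc1, hc⟩ := coord_bound b x
  refine ⟨((2 ^ 2 * (2 * c) ^ 2) ^ (17 * d)) ^ (8 * d), Nat.one_le_pow _ _ (by positivity),
    fun e he => ?_⟩
  set a := 8 * d * e + 9 * e with ha
  set b' := 8 * d * e - 7 * e with hb'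
  have hde : 2 * e ≤ d * e := Nat.mul_le_mul_right _ hd
  have hab : a + b' = 16 * e * d + 2 * e := by
    have : 8 * d * e = 8 * (d * e) := by ring
    have h2 : 16 * e * d = 16 * (d * e) := by ring
    omega
  have hba : b' ≤ a := by omega
  have ha17 : a ≤ 17 * d * e := by nlinarith
  let w : ℕ → ℕ → AdjoinRoot g := fun k i => (i.choose k : AdjoinRoot g) * x ^ (i - k)
  let Mx : Matrix (Fin (16 * e) × Fin d) (Fin a ⊕ Fin b') ℤ := fun kl s =>
    Sum.elim (fun i : Fin a => (i.1.choose kl.1.1 : ℤ) * b.repr (x ^ (i.1 - kl.1.1)) kl.2)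
      (fun i : Fin b' => (i.1.choose kl.1.1 : ℤ) * b.repr (x ^ (i.1 - kl.1.1 + 1)) kl.2) s
  set M := (2 * c) ^ (2 * a) with hM
  have hch : ∀ i k : ℕ, i < a → (i.choose k : ℤ) ≤ 2 ^ (2 * a) := by
    intro i k hi
    have h1 : i.choose k ≤ 2 ^ i := Nat.choose_le_two_pow i k
    have h2 : 2 ^ i ≤ 2 ^ (2 * a) := Nat.pow_le_pow_right (by norm_num) (by omega)
    exact_mod_cast h1.trans h2
  have hcc : ∀ j, j < 2 * a → (c : ℤ) ^ (j + 1) ≤ (c : ℤ) ^ (2 * a) := by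
    intro j hj
    exact pow_le_pow_right₀ (by exact_mod_cast hc1) (by omega)
  have hMb : ∀ i j, |Mx i j| ≤ (M : ℕ) := by
    rintro ⟨k, l⟩ (i | i)
    · simp only [Mx, Sum.elim_inl, abs_mul, hM]
      push_cast
      rw [mul_pow, Nat.abs_cast]
      have := i.2
      exact mul_le_mul (hch _ _ i.2) ((hc _ _).trans (hcc _ (by omega))) (abs_nonneg _)
        (by positivity)
    · simp only [Mx, Sum.elim_inr, abs_mul, hM]
      push_cast
      rw [mul_pow, Nat.abs_cast]
      have := i.2
      exact mul_le_mul (hch _ _ (by omega)) ((hc _ _).trans (hcc _ (by omega))) (abs_nonneg _)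
        (by positivity)
  have hα : Fintype.card (Fin (16 * e) × Fin d) = 16 * e * d := by simp
  have hβ : Fintype.card (Fin a ⊕ Fin b') = 16 * e * d + 2 * e := by simp [hab]
  obtain ⟨t, ht0, ht, htb⟩ := siegel_int Mx (8 * d) M (by rw [hα]; positivity)
    (by rw [hα, hβ]; omega) (by rw [hα, hβ, Nat.add_sub_cancel_left]; ring)
    (Nat.one_le_pow _ _ (by omega)) hMb
  rw [hβ] at htb
  have htb' : ∀ j, |t j| ≤ (((2 ^ 2 * (2 * c) ^ 2) ^ (17 * d)) ^ (8 * d) : ℕ) ^ e := by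
    intro j
    refine (htb j).trans ?_
    norm_cast
    rw [← pow_mul, mul_comm (8 * d) e, pow_mul _ e]
    refine Nat.pow_le_pow_left ?_ _
    rw [← pow_mul]
    calc (16 * e * d + 2 * e) * M ≤ 2 ^ (2 * a) * (2 * c) ^ (2 * a) := by
          refine Nat.mul_le_mul_right _ ?_
          have := (Nat.lt_two_pow_self (n := 2 * a)).le
          omega
      _ = (2 ^ 2 * (2 * c) ^ 2) ^ a := by rw [mul_pow (2 ^ 2), ← pow_mul, ← pow_mul]
      _ ≤ _ := Nat.pow_le_pow_right (by positivity) ha17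
  let A : ℤ[X] := ∑ i : Fin a, monomial i.1 (t (Sum.inl i))
  let B : ℤ[X] := ∑ i : Fin b', monomial i.1 (t (Sum.inr i))
  have hAc : ∀ i, A.coeff i = if h : i < a then t (Sum.inl ⟨i, h⟩) else 0 := by
    intro i
    simp only [A, finsetSum_coeff, coeff_monomial]
    split_ifs with h
    · rw [Finset.sum_eq_single ⟨i, h⟩] <;> simp +contextual [Fin.ext_iff]
    · refine Finset.sum_eq_zero fun j _ => if_neg ?_
      have := j.2; omega
  have hBc : ∀ i, B.coeff i = if h : i < b' then t (Sum.inr ⟨i, h⟩) else 0 := by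
    intro i
    simp only [B, finsetSum_coeff, coeff_monomial]
    split_ifs with h
    · rw [Finset.sum_eq_single ⟨i, h⟩] <;> simp +contextual [Fin.ext_iff]
    · refine Finset.sum_eq_zero fun j _ => if_neg ?_
      have := j.2; omega
  refine ⟨A, B, ?_, ?_, ?_, ?_, ?_, ?_⟩
  · rintro ⟨h1, h2⟩
    apply ht0
    ext (i | i)
    · have := hAc i.1
      rw [h1, dif_pos i.2] at this
      simpa using this.symm
    · have := hBc i.1
      rw [h2, dif_pos i.2] at this
      simpa using this.symm
  · rw [degree_lt_iff_coeff_zero]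
    intro m hm
    rw [hAc, dif_neg (by omega)]
  · rw [degree_lt_iff_coeff_zero]
    intro m hm
    rw [hBc, dif_neg (by omega)]
  · intro i
    rw [hAc]
    split_ifs
    · exact htb' _
    · simp only [abs_zero]; positivity
  · intro i
    rw [hBc]
    split_ifs
    · exact htb' _
    · simp only [abs_zero]; positivity
  · apply dvd_of_hasse
    intro k hk
    have e1 : (hasseDeriv k (A.map (algebraMap ℤ (AdjoinRoot g)) +
          C x * B.map (algebraMap ℤ (AdjoinRoot g)))).eval x
        = ∑ i : Fin a, t (Sum.inl i) • ((i.1.choose k : ℤ) • x ^ (i.1 - k))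
          + ∑ i : Fin b', t (Sum.inr i) • ((i.1.choose k : ℤ) • x ^ (i.1 - k + 1)) := by
      rw [← smul_eq_C_mul]
      simp only [A, B, Polynomial.map_sum, map_monomial, map_add, map_smul, map_sum,
        hasseDeriv_monomial, eval_add, eval_smul, eval_finsetSum, eval_monomial]
      congr 1
      · refine Finset.sum_congr rfl fun i _ => ?_
        simp [zsmul_eq_mul]; ring
      · rw [smul_eq_mul, Finset.mul_sum]
        refine Finset.sum_congr rfl fun i _ => ?_
        simp [zsmul_eq_mul]; ring
    rw [e1]
    apply b.repr.injective
    ext l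
    have := congrFun ht (⟨k, hk⟩, l)
    simp only [Matrix.mulVec, dotProduct, Fintype.sum_sum_type, Mx, Sum.elim_inl, Sum.elim_inr,
      Pi.zero_apply] at this
    simp only [map_add, map_sum, map_smul, Finsupp.add_apply, Finsupp.finsetSum_apply,
      Finsupp.smul_apply, smul_eq_mul, map_zero, Finsupp.zero_apply]
    rw [← this]
    congr 1 <;> exact Finset.sum_congr rfl fun i _ => by ring

lemma dvd_wronskian {F : Type*} [Field F] (A B : F[X]) (x c : F) (E : ℕ)
    (h : (X - C x) ^ E ∣ A + C c * B) : (X - C x) ^ (E - 1) ∣ wronskian A B := by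
  have e1 : wronskian A B = (A + C c * B) * derivative B - derivative (A + C c * B) * B := by
    simp only [wronskian, derivative_add, derivative_mul, derivative_C]; ring
  rw [e1]
  refine dvd_sub (Dvd.dvd.mul_right ((pow_dvd_pow _ (Nat.sub_le _ _)).trans h) _)
    (Dvd.dvd.mul_right ?_ _)
  exact pow_sub_one_dvd_derivative_of_pow_dvd h

lemma prod_dvd_card {F : Type*} [Field F] (h : F[X]) (s : Finset F) (E : ℕ)
    (hs : ∀ x ∈ s, (X - C x) ^ E ∣ h) : ∏ x ∈ s, (X - C x) ^ E ∣ h := by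
  refine Finset.prod_dvd_of_coprime ?_ hs
  intro x _ y _ hxy
  exact (pairwise_coprime_X_sub_C (s := fun x : F => x) (fun _ _ h => h) hxy).pow

lemma natDegree_prod_pow {F : Type*} [Field F] (s : Finset F) (E : ℕ) :
    (∏ x ∈ s, (X - C x) ^ E : F[X]).natDegree = s.card * E := by
  rw [natDegree_prod_of_monic _ _ fun x _ => (monic_X_sub_C x).pow E]
  simp [natDegree_pow]

lemma wronskian_ne {F : Type*} [Field F] [CharZero F] (A B : F[X]) (s : Finset F) (E : ℕ)
    (hAB : ¬ (A = 0 ∧ B = 0))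
    (hA : A.degree < ((s.card * E : ℕ) : WithBot ℕ))
    (hB : B.degree < (((s.card - 1) * E : ℕ) : WithBot ℕ))
    (hs : ∀ x ∈ s, (X - C x) ^ E ∣ A + C x * B) : wronskian A B ≠ 0 := by
  classical
  intro hW
  have hg0 : EuclideanDomain.gcd A B ≠ 0 := by
    rw [Ne, EuclideanDomain.gcd_eq_zero_iff]; exact hAB
  obtain ⟨h, A₁, B₁, hh, hco, rfl, rfl⟩ :
      ∃ h A₁ B₁ : F[X], h ≠ 0 ∧ IsCoprime A₁ B₁ ∧ A = h * A₁ ∧ B = h * B₁ := by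
    obtain ⟨A₁, h1⟩ := EuclideanDomain.gcd_dvd_left A B
    obtain ⟨B₁, h2⟩ := EuclideanDomain.gcd_dvd_right A B
    refine ⟨_, A₁, B₁, hg0, ?_, h1, h2⟩
    refine ⟨EuclideanDomain.gcdA A B, EuclideanDomain.gcdB A B, ?_⟩
    apply mul_left_cancel₀ hg0
    have := EuclideanDomain.gcd_eq_gcd_ab A B
    calc EuclideanDomain.gcd A B * (EuclideanDomain.gcdA A B * A₁ + EuclideanDomain.gcdB A B * B₁)
        = (EuclideanDomain.gcd A B * A₁) * EuclideanDomain.gcdA A B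
          + (EuclideanDomain.gcd A B * B₁) * EuclideanDomain.gcdB A B := by ring
      _ = A * EuclideanDomain.gcdA A B + B * EuclideanDomain.gcdB A B := by rw [← h1, ← h2]
      _ = _ := by rw [← this, mul_one]
  have hW1 : wronskian A₁ B₁ = 0 := by
    have : wronskian (h * A₁) (h * B₁) = h ^ 2 * wronskian A₁ B₁ := by
      simp only [wronskian, derivative_mul]; ring
    rw [this] at hW
    exact (mul_eq_zero.1 hW).resolve_left (pow_ne_zero _ hh)
  obtain ⟨hA1, hB1⟩ := hco.wronskian_eq_zero_iff.1 hW1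
  obtain ⟨u, rfl⟩ : ∃ u, A₁ = C u := ⟨_, eq_C_of_derivative_eq_zero hA1⟩
  obtain ⟨v, rfl⟩ : ∃ v, B₁ = C v := ⟨_, eq_C_of_derivative_eq_zero hB1⟩
  have huv : ∀ x ∈ s, u + x * v ≠ 0 → (X - C x) ^ E ∣ h := by
    intro x hx hne
    have h1 := hs x hx
    have e1 : h * C u + C x * (h * C v) = h * C (u + x * v) := by
      simp only [C_add, C_mul]; ring
    rw [e1] at h1
    exact (IsUnit.dvd_mul_right (isUnit_C.2 (IsUnit.mk0 _ hne))).1 h1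
  by_cases hv : v = 0
  · subst hv
    have hu : u ≠ 0 := by
      rintro rfl
      apply hAB; simp
    have h2 := prod_dvd_card h s E fun x hx => huv x hx (by simpa using hu)
    have h3 := natDegree_le_of_dvd h2 hh
    rw [natDegree_prod_pow] at h3
    rw [degree_mul, degree_C hu, add_zero, degree_eq_natDegree hh] at hA
    have : h.natDegree < s.card * E := by exact_mod_cast hA
    omega
  · have h2 := prod_dvd_card h (s.erase (-u / v)) E fun x hx => by
      refine huv x (Finset.mem_of_mem_erase hx) fun h0 => ?_
      apply Finset.ne_of_mem_erase hx
      rw [eq_div_iff hv]; linear_combination h0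
    have h3 := natDegree_le_of_dvd h2 hh
    rw [natDegree_prod_pow] at h3
    rw [degree_mul, degree_C hv, add_zero, degree_eq_natDegree hh] at hB
    have : h.natDegree < (s.card - 1) * E := by exact_mod_cast hB
    have h5 : (s.card - 1) * E ≤ (s.erase (-u / v)).card * E :=
      Nat.mul_le_mul_right _ Finset.pred_card_le_card_erase
    omega

lemma zero_est (g : ℤ[X]) (hg : g.Monic) (hd : 2 ≤ g.natDegree)
    (hsep : (g.map (Int.castRingHom ℂ)).Separable) (e : ℕ) (he : 1 ≤ e) (A B : ℤ[X])
    (hAB : ¬ (A = 0 ∧ B = 0))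
    (hA : A.degree < ((8 * g.natDegree * e + 9 * e : ℕ) : WithBot ℕ))
    (hB : B.degree < ((8 * g.natDegree * e - 7 * e : ℕ) : WithBot ℕ))
    (hdvd : (X - C (AdjoinRoot.root g)) ^ (16 * e) ∣
        A.map (algebraMap ℤ (AdjoinRoot g)) +
          C (AdjoinRoot.root g) * B.map (algebraMap ℤ (AdjoinRoot g)))
    (n₁ n₂ : ℤ) (hn : g.eval n₁ ≠ 0) :
    ∃ k ≤ 2 * e + g.natDegree,
      (hasseDeriv k A).eval n₁ + n₂ * (hasseDeriv k B).eval n₁ ≠ 0 := by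
  classical
  by_contra! hcon
  set d := g.natDegree with hdd
  have hde : 2 * e ≤ d * e := Nat.mul_le_mul_right _ hd
  set φ := Int.castRingHom ℂ with hφ
  have hφi : Function.Injective φ := Int.cast_injective
  set s : Finset ℂ := (g.map φ).roots.toFinset with hs
  have hg0 : g.map φ ≠ 0 := (hg.map φ).ne_zero
  have hcard : s.card = d := by
    rw [hs, Multiset.toFinset_card_of_nodup (nodup_roots hsep),
      (splits_iff_card_roots.1 (IsAlgClosed.splits _)), hg.natDegree_map]
  have hroot : ∀ x ∈ s, (X - C x) ^ (16 * e) ∣ A.map φ + C x * B.map φ := by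
    intro x hx
    have hx' : g.eval₂ φ x = 0 := by
      rw [hs, Multiset.mem_toFinset, mem_roots hg0, IsRoot.def, eval_map] at hx
      exact hx
    have := Polynomial.map_dvd (AdjoinRoot.lift φ x hx') hdvd
    have hc : (AdjoinRoot.lift φ x hx').comp (algebraMap ℤ (AdjoinRoot g)) = φ :=
      RingHom.ext_int _ _
    simpa [Polynomial.map_map, hc] using this
  have hA' : (A.map φ).degree = A.degree := degree_map_eq_of_injective hφi A
  have hB' : (B.map φ).degree = B.degree := degree_map_eq_of_injective hφi B
  have hAB' : ¬ (A.map φ = 0 ∧ B.map φ = 0) := by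
    rwa [Polynomial.map_eq_zero_iff hφi, Polynomial.map_eq_zero_iff hφi]
  have hW := wronskian_ne (A.map φ) (B.map φ) s (16 * e) hAB'
    (by
      rw [hA', hcard]
      refine hA.trans_le ?_
      have : 8 * d * e + 9 * e ≤ d * (16 * e) := by nlinarith
      exact_mod_cast this)
    (by
      rw [hB', hcard]
      refine hB.trans_le ?_
      have : 8 * d * e - 7 * e ≤ (d - 1) * (16 * e) := by
        have h1 : (d - 1) * (16 * e) = 16 * (d * e) - 16 * e := by
          rw [Nat.sub_mul, one_mul]; congr 1; ring
        have h2 : 8 * d * e = 8 * (d * e) := by ring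
        omega
      exact_mod_cast this)
    hroot
  have hdeg := natDegree_wronskian_lt_add hW
  have h1 : ∏ x ∈ s, (X - C x) ^ (16 * e - 1) ∣ wronskian (A.map φ) (B.map φ) :=
    prod_dvd_card _ s _ fun x hx => dvd_wronskian _ _ x x _ (hroot x hx)
  have h2 : (X - C (n₁ : ℂ)) ^ (2 * e + d + 1 - 1) ∣ wronskian (A.map φ) (B.map φ) := by
    refine dvd_wronskian _ _ _ (n₂ : ℂ) _ ?_
    apply dvd_of_hasse
    intro k hk
    have := hcon k (by omega)
    have h3 := congrArg φ this
    rw [← smul_eq_C_mul]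
    have hm : ∀ Q : ℤ[X], (hasseDeriv k (Q.map φ)).eval (n₁ : ℂ)
        = φ ((hasseDeriv k Q).eval n₁) := by
      intro Q
      have : hasseDeriv k (Q.map φ) = (hasseDeriv k Q).map φ := by
        ext i; simp [hasseDeriv_coeff]
      rw [this]
      have := eval_intCast_map φ (hasseDeriv k Q) n₁
      exact this
    simp only [map_add, map_smul, eval_add, eval_smul, hm]
    simpa using h3
  have hn1 : (n₁ : ℂ) ∉ s := by
    intro hx
    rw [hs, Multiset.mem_toFinset, mem_roots hg0, IsRoot.def] at hx
    have := eval_intCast_map φ g n₁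
    rw [hx] at this
    apply hn
    apply hφi
    rw [map_zero]; exact this.symm
  have hco : IsCoprime (∏ x ∈ s, (X - C x) ^ (16 * e - 1))
      ((X - C (n₁ : ℂ)) ^ (2 * e + d + 1 - 1)) := by
    refine IsCoprime.prod_left fun x hx => ?_
    have hne : x ≠ n₁ := fun h => hn1 (h ▸ hx)
    exact (pairwise_coprime_X_sub_C (s := fun x : ℂ => x) (fun _ _ h => h) hne).pow
  have h3 := natDegree_le_of_dvd (hco.mul_dvd h1 h2) hW
  rw [natDegree_mul (monic_prod_of_monic _ _ fun x _ => (monic_X_sub_C x).pow _).ne_zero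
    ((monic_X_sub_C _).pow _).ne_zero, natDegree_prod_pow, natDegree_pow, natDegree_X_sub_C,
    hcard] at h3
  rw [natDegree_map_eq_of_injective hφi, natDegree_map_eq_of_injective hφi] at hdeg
  have hAn : A.natDegree ≤ 8 * d * e + 9 * e := natDegree_le_of_degree_le hA.le
  have hBn : B.natDegree ≤ 8 * d * e - 7 * e := natDegree_le_of_degree_le hB.le
  have : d * (16 * e - 1) = 16 * (d * e) - d := by
    rw [Nat.mul_sub, mul_one]; congr 1; ring
  have h8 : 8 * d * e = 8 * (d * e) := by ring
  have : d ≤ d * e := Nat.le_mul_of_pos_right _ he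
  omega

lemma hasse_bound (A : ℤ[X]) (a k H : ℕ) (hA : A.degree < (a : WithBot ℕ))
    (hc : ∀ i, |A.coeff i| ≤ (H : ℤ)) (n : ℕ) (hn : 1 ≤ n) :
    |(hasseDeriv k A).eval (n : ℤ)| ≤ (4 ^ a * H * n ^ a : ℕ) := by
  have e1 : (hasseDeriv k A).eval (n : ℤ)
      = ∑ i ∈ Finset.range a, (i.choose k : ℤ) * A.coeff i * (n : ℤ) ^ (i - k) := by
    rw [hasseDeriv_apply, sum_over_range' _ (fun i => by simp) (a + 1)
      (by have := natDegree_le_of_degree_le hA.le; omega), Finset.sum_range_succ,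
      (degree_lt_iff_coeff_zero A a).1 hA a le_rfl]
    simp [eval_finsetSum, eval_monomial]
  rw [e1]
  refine (Finset.abs_sum_le_sum_abs _ _).trans ?_
  have h1 : ∀ i ∈ Finset.range a, |(i.choose k : ℤ) * A.coeff i * (n : ℤ) ^ (i - k)|
      ≤ (2 : ℤ) ^ a * H * (n : ℤ) ^ a := by
    intro i hi
    have hi' := Finset.mem_range.1 hi
    rw [abs_mul, abs_mul, Nat.abs_cast, abs_of_nonneg (by positivity : (0 : ℤ) ≤ (n : ℤ) ^ (i - k))]
    have h2 : (i.choose k : ℤ) ≤ 2 ^ a := by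
      exact_mod_cast (Nat.choose_le_two_pow i k).trans
        (Nat.pow_le_pow_right (by norm_num) hi'.le)
    have h3 : (n : ℤ) ^ (i - k) ≤ (n : ℤ) ^ a :=
      pow_le_pow_right₀ (by exact_mod_cast hn) (by omega)
    exact mul_le_mul (mul_le_mul h2 (hc i) (abs_nonneg _) (by positivity)) h3 (by positivity)
      (by positivity)
  refine (Finset.sum_le_sum h1).trans ?_
  rw [Finset.sum_const, Finset.card_range, nsmul_eq_mul]
  have h4 : (a : ℤ) ≤ 2 ^ a := by exact_mod_cast (Nat.lt_two_pow_self (n := a)).le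
  push_cast
  have h5 : (4 : ℤ) ^ a = 2 ^ a * 2 ^ a := by rw [← mul_pow]; norm_num
  rw [h5]
  calc (a : ℤ) * (2 ^ a * H * (n : ℤ) ^ a) ≤ 2 ^ a * (2 ^ a * H * (n : ℤ) ^ a) :=
        mul_le_mul_of_nonneg_right h4 (by positivity)
    _ = _ := by ring

lemma growth (g : ℤ[X]) (hg : g.Monic) (hd : 1 ≤ g.natDegree) :
    ∃ c : ℕ, 1 ≤ c ∧ ∀ n : ℕ, c ≤ n →
      (n : ℤ) ^ g.natDegree ≤ 2 * |g.eval (n : ℤ)| ∧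
      |g.eval (n : ℤ)| ≤ c * (n : ℤ) ^ g.natDegree := by
  set d := g.natDegree with hdd
  set S : ℤ := ∑ i ∈ Finset.range d, |g.coeff i| with hS
  have hS0 : 0 ≤ S := Finset.sum_nonneg fun i _ => abs_nonneg _
  refine ⟨(2 * S + 1).toNat, by omega, fun n hn => ?_⟩
  have hn1 : (2 * S + 1) ≤ (n : ℤ) := by omega
  have hc : ((2 * S + 1).toNat : ℤ) = 2 * S + 1 := Int.toNat_of_nonneg (by omega)
  rw [hc]
  have e1 : g.eval (n : ℤ) = (n : ℤ) ^ d + ∑ i ∈ Finset.range d, g.coeff i * (n : ℤ) ^ i := by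
    rw [eval_eq_sum_range, Finset.sum_range_succ, ← hdd]
    have : g.coeff d = 1 := hg
    rw [this]; ring
  have e2 : |∑ i ∈ Finset.range d, g.coeff i * (n : ℤ) ^ i| ≤ S * (n : ℤ) ^ (d - 1) := by
    refine (Finset.abs_sum_le_sum_abs _ _).trans ?_
    rw [hS, Finset.sum_mul]
    refine Finset.sum_le_sum fun i hi => ?_
    rw [abs_mul, abs_of_nonneg (by positivity : (0 : ℤ) ≤ (n : ℤ) ^ i)]
    refine mul_le_mul_of_nonneg_left ?_ (abs_nonneg _)
    exact pow_le_pow_right₀ (by omega) (by have := Finset.mem_range.1 hi; omega)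
  have e3 : (n : ℤ) ^ d = n * (n : ℤ) ^ (d - 1) := by
    rw [← pow_succ']; congr 1; omega
  rw [abs_le] at e2
  clear_value S
  have hpos : (1 : ℤ) ≤ (n : ℤ) ^ (d - 1) := one_le_pow₀ (by omega)
  rw [e1, e3]
  set T := ∑ i ∈ Finset.range d, g.coeff i * (n : ℤ) ^ i
  set Y := (n : ℤ) ^ (d - 1)
  clear_value T Y
  have h6 : 2 * (S * Y) + Y ≤ n * Y := by nlinarith
  have h0 : 0 ≤ S * Y := by positivity
  have h7 : (2 * S + 1) * (n * Y) = 2 * (S * (n * Y)) + n * Y := by ring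
  have h8 : S * Y ≤ S * (n * Y) := by
    apply mul_le_mul_of_nonneg_left _ hS0
    nlinarith
  constructor
  · rw [abs_of_nonneg (by omega)]; omega
  · rw [abs_of_nonneg (by omega), h7]; omega

lemma hensel (p : ℕ) (hp : p.Prime) (g : ℤ[X]) (Δ : ℤ) (hΔ : Δ ≠ 0) (u v : ℤ[X])
    (huv : u * g + v * derivative g = C Δ) :
    ∃ δ : ℕ, ∀ (n₁ n₂ : ℤ) (m : ℕ), (p : ℤ) ^ m ∣ g.eval n₁ → (p : ℤ) ^ m ∣ g.eval n₂ →
      (p : ℤ) ^ δ ∣ n₂ - n₁ → (p : ℤ) ^ (m - δ) ∣ n₂ - n₁ := by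
  have hp' : Prime (p : ℤ) := Nat.prime_iff_prime_int.1 hp
  obtain ⟨δ, hδ⟩ : ∃ δ : ℕ, ¬ (p : ℤ) ^ δ ∣ Δ := by
    refine ⟨Δ.natAbs, fun h => ?_⟩
    have h1 := Int.natAbs_dvd_natAbs.2 h
    have h2 := Nat.le_of_dvd (Int.natAbs_pos.2 hΔ) h1
    rw [Int.natAbs_pow, Int.natAbs_natCast] at h2
    have := Nat.lt_pow_self hp.one_lt (n := Δ.natAbs)
    omega
  refine ⟨δ, fun n₁ n₂ m h1 h2 h3 => ?_⟩
  by_cases hm : m ≤ δ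
  · simp [Nat.sub_eq_zero_of_le hm]
  push Not at hm
  obtain ⟨t, ht⟩ := g.binomExpansion n₁ (n₂ - n₁)
  rw [add_sub_cancel] at ht
  set s := (derivative g).eval n₁ + t * (n₂ - n₁) with hs
  have hsd : ¬ (p : ℤ) ^ δ ∣ s := by
    intro h
    apply hδ
    have h4 : (p : ℤ) ^ δ ∣ (derivative g).eval n₁ := by
      have := dvd_sub h (Dvd.dvd.mul_left h3 t)
      rwa [hs, add_sub_cancel_right] at this
    have h5 := congrArg (eval n₁) huv
    rw [eval_C, eval_add, eval_mul, eval_mul] at h5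
    rw [← h5]
    exact dvd_add (Dvd.dvd.mul_left ((pow_dvd_pow _ hm.le).trans h1) _) (Dvd.dvd.mul_left h4 _)
  have hprod : (p : ℤ) ^ m ∣ (n₂ - n₁) * s := by
    have : (n₂ - n₁) * s = g.eval n₂ - g.eval n₁ := by rw [ht, hs]; ring
    rw [this]; exact dvd_sub h2 h1
  by_cases h0 : n₂ - n₁ = 0
  · rw [h0]; exact dvd_zero _
  rw [pow_dvd_iff_le_emultiplicity] at hprod hsd ⊢
  rw [emultiplicity_mul hp'] at hprod
  have hsf : emultiplicity (p : ℤ) s < δ := not_le.1 hsd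
  obtain ⟨i, hi⟩ := ENat.ne_top_iff_exists.1 (hsf.trans_le le_top).ne
  have hfin : FiniteMultiplicity (p : ℤ) (n₂ - n₁) :=
    Int.finiteMultiplicity_iff.2 ⟨by simpa using hp.ne_one, h0⟩
  rw [hfin.emultiplicity_eq_multiplicity] at hprod ⊢
  rw [← hi] at hprod hsf
  norm_cast at hprod hsf ⊢
  omega

set_option maxHeartbeats 2000000 in
lemma thue_step (p : ℕ) (hp : p.Prime) (g : ℤ[X]) (hg : g.Monic) (hd : 2 ≤ g.natDegree)
    (hsep : (g.map (Int.castRingHom ℂ)).Separable) (B₀ : ℕ) (hB₀ : 1 ≤ B₀) (δ : ℕ)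
    (hδ : ∀ (n₁ n₂ : ℤ) (m : ℕ), (p : ℤ) ^ m ∣ g.eval n₁ → (p : ℤ) ^ m ∣ g.eval n₂ →
      (p : ℤ) ^ δ ∣ n₂ - n₁ → (p : ℤ) ^ (m - δ) ∣ n₂ - n₁) :
    ∃ N₁ : ℕ, ∀ (n₁ m₁ : ℕ), N₁ < n₁ → (p : ℤ) ^ m₁ ∣ g.eval (n₁ : ℤ) → g.eval (n₁ : ℤ) ≠ 0 →
      |g.eval (n₁ : ℤ)| ≤ B₀ * (p : ℤ) ^ m₁ → ∃ N₂ : ℕ, ∀ n₂ m₂ : ℕ,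
      (p : ℤ) ^ m₂ ∣ g.eval (n₂ : ℤ) → g.eval (n₂ : ℤ) ≠ 0 →
      |g.eval (n₂ : ℤ)| ≤ B₀ * (p : ℤ) ^ m₂ → (p : ℤ) ^ δ ∣ (n₂ : ℤ) - n₁ → n₂ ≤ N₂ := by
  set d := g.natDegree with hdd
  obtain ⟨K, hK1, hK⟩ := aux_exists g hg hd
  obtain ⟨c, hc1, hc⟩ := growth g hg (by omega)
  rw [← hdd] at hK hc
  set C₁ := 2 * 4 ^ (17 * d) * K with hC₁
  set C₂ := 2 * B₀ * p ^ δ with hC₂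
  have hpδ : 1 ≤ p ^ δ := Nat.one_le_pow _ _ hp.pos
  have hC₂1 : 1 ≤ C₂ := by rw [hC₂]; nlinarith
  have hC₂B : 2 * B₀ ≤ C₂ := by rw [hC₂]; nlinarith
  refine ⟨C₁ * C₂ ^ 16 + c + C₂ + 1, fun n₁ m₁ hn₁ h1d h10 h1b => ?_⟩
  refine ⟨n₁ ^ (16 * (d ^ 2 + 16)), fun n₂ m₂ h2d h20 h2b hcong => ?_⟩
  by_contra! hn₂
  have hn1 : 1 < n₁ := by omega
  set e := Nat.log n₁ n₂ / 16 with he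
  have hn20 : n₂ ≠ 0 := by omega
  have hlog : 16 * (d ^ 2 + 16) ≤ Nat.log n₁ n₂ := (Nat.le_log_iff_pow_le hn1 hn20).2 hn₂.le
  have he0 : d ^ 2 + 16 ≤ e := by omega
  have hlow : n₁ ^ (16 * e) ≤ n₂ := (Nat.le_log_iff_pow_le hn1 hn20).1 (by omega)
  have hup : n₂ ≤ n₁ ^ (16 * e + 16) :=
    ((Nat.log_lt_iff_lt_pow hn1 hn20).1 (by omega)).le
  clear_value e
  have he1 : 1 ≤ e := by omega
  have hn12 : n₁ ≤ n₂ := le_trans (by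
    calc n₁ = n₁ ^ 1 := (pow_one _).symm
      _ ≤ _ := Nat.pow_le_pow_right (by omega) (by omega)) hlow
  have hg1 : n₁ ^ d ≤ 2 * B₀ * p ^ m₁ := by
    have := (hc n₁ (by omega)).1
    have h : (n₁ : ℤ) ^ d ≤ 2 * B₀ * (p : ℤ) ^ m₁ := by linarith
    exact_mod_cast h
  have hg2 : n₂ ^ d ≤ 2 * B₀ * p ^ m₂ := by
    have := (hc n₂ (by omega)).1
    have h : (n₂ : ℤ) ^ d ≤ 2 * B₀ * (p : ℤ) ^ m₂ := by linarith
    exact_mod_cast h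
  have hg1' : p ^ m₁ ≤ c * n₁ ^ d := by
    have h1 := (hc n₁ (by omega)).2
    have h2 := Int.le_of_dvd (abs_pos.2 h10) ((dvd_abs _ _).2 h1d)
    exact_mod_cast h2.trans h1
  have hm12 : m₁ ≤ m₂ := by
    by_contra! hlt
    have h1 : p ^ m₂ ≤ p ^ m₁ := Nat.pow_le_pow_right hp.pos hlt.le
    have h2 : n₁ ^ 3 ≤ n₂ := (Nat.pow_le_pow_right (by omega) (by omega)).trans hlow
    have h3 : (n₁ ^ 3) ^ d ≤ 2 * B₀ * (c * n₁ ^ d) :=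
      (Nat.pow_le_pow_left h2 d).trans (hg2.trans (Nat.mul_le_mul_left _ (h1.trans hg1')))
    have h4 : (n₁ ^ 3) ^ d = (n₁ ^ 2) ^ d * n₁ ^ d := by
      rw [← mul_pow]; congr 1
    have h5 : n₁ ^ 2 ≤ (n₁ ^ 2) ^ d := Nat.le_self_pow (by omega) _
    have h6 : 0 < n₁ ^ d := by positivity
    rw [h4, ← mul_assoc] at h3
    have h7 := Nat.le_of_mul_le_mul_right h3 h6
    have h8 : 2 * B₀ * c < n₁ * n₁ := Nat.mul_lt_mul'' (by omega) (by omega)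
    nlinarith
  obtain ⟨A, B, hAB, hA, hB, hAc, hBc, hdvd⟩ := hK e he1
  obtain ⟨k, hk, hZ⟩ := zero_est g hg hd hsep e he1 A B hAB hA hB hdvd n₁ n₂ h10
  rw [← hdd] at hk
  set Z := (hasseDeriv k A).eval (n₁ : ℤ) + n₂ * (hasseDeriv k B).eval (n₁ : ℤ) with hZd
  set t := min m₂ ((m₁ - δ) * (16 * e - k)) with ht
  set q := p ^ t with hq
  have hcong' := hδ n₁ n₂ m₁ h1d ((pow_dvd_pow _ hm12).trans h2d) hcong
  have hqZ : (q : ℤ) ∣ Z := by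
    have hq2 : (q : ℤ) ∣ g.eval (n₂ : ℤ) := by
      rw [hq]; push_cast
      exact (pow_dvd_pow _ (min_le_left _ _)).trans h2d
    have hq1 : (q : ℤ) ∣ ((n₁ : ℤ) - n₂) ^ (16 * e - k) := by
      rw [hq]; push_cast
      refine (pow_dvd_pow _ (min_le_right _ _)).trans ?_
      rw [pow_mul]
      exact pow_dvd_pow_of_dvd ((dvd_sub_comm).1 hcong') _
    have hev : g.eval₂ (Int.castRingHom (ZMod q)) ((n₂ : ℤ) : ZMod q) = 0 := by
      rw [← eval_map, eval_intCast_map]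
      exact (ZMod.intCast_zmod_eq_zero_iff_dvd _ q).2 hq2
    let ψ : AdjoinRoot g →+* ZMod q := AdjoinRoot.lift (Int.castRingHom (ZMod q)) _ hev
    have hm := hasse_dvd _ (AdjoinRoot.root g) ((n₁ : ℤ) : AdjoinRoot g) (16 * e) k hdvd
    have hm2 := map_dvd ψ hm
    have hl : ψ ((((n₁ : ℤ) : AdjoinRoot g) - AdjoinRoot.root g) ^ (16 * e - k)) = 0 := by
      rw [map_pow, map_sub, map_intCast]
      simp only [ψ, AdjoinRoot.lift_root]
      have := (ZMod.intCast_zmod_eq_zero_iff_dvd _ q).2 hq1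
      simpa using this
    rw [hl, zero_dvd_iff] at hm2
    have hmA : ∀ Q : ℤ[X], (hasseDeriv k (Q.map (algebraMap ℤ (AdjoinRoot g)))).eval
        ((n₁ : ℤ) : AdjoinRoot g) = (((hasseDeriv k Q).eval (n₁ : ℤ) : ℤ) : AdjoinRoot g) := by
      intro Q
      have : hasseDeriv k (Q.map (algebraMap ℤ (AdjoinRoot g)))
          = (hasseDeriv k Q).map (algebraMap ℤ (AdjoinRoot g)) := by
        ext i; simp [hasseDeriv_coeff]
      rw [this, eval_intCast_map]
      simp
    rw [← smul_eq_C_mul] at hm2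
    simp only [map_add, map_smul, eval_add, eval_smul, hmA, smul_eq_mul, map_mul, map_intCast] at hm2
    simp only [ψ, AdjoinRoot.lift_root] at hm2
    rw [← ZMod.intCast_zmod_eq_zero_iff_dvd, hZd]
    simpa using hm2
  have hqle : (q : ℤ) ≤ |Z| := Int.le_of_dvd (abs_pos.2 hZ) ((dvd_abs _ _).2 hqZ)
  have hde : 2 * e ≤ d * e := Nat.mul_le_mul_right _ hd
  set a := 8 * d * e + 9 * e with ha
  set b' := 8 * d * e - 7 * e with hb'
  have h8 : 8 * d * e = 8 * (d * e) := by ring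
  have hba : b' + 16 * e = a := by omega
  have ha17 : a ≤ 17 * d * e := by
    have h17 : 17 * d * e = 17 * (d * e) := by ring
    omega
  have hKc : ((K ^ e : ℕ) : ℤ) = (K : ℤ) ^ e := by push_cast; rfl
  have hA1 := hasse_bound A a k (K ^ e) hA (by rw [hKc]; exact hAc) n₁ hn1.le
  have hB1 := hasse_bound B b' k (K ^ e) hB (by rw [hKc]; exact hBc) n₁ hn1.le
  have hqN : q ≤ C₁ ^ e * n₁ ^ (a + 16) := by
    have h1 : |Z| ≤ ((4 ^ a * K ^ e * n₁ ^ a + n₂ * (4 ^ b' * K ^ e * n₁ ^ b') : ℕ) : ℤ) := by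
      rw [hZd]
      refine (abs_add_le _ _).trans ?_
      rw [abs_mul, Nat.abs_cast]
      push_cast at hA1 hB1 ⊢
      exact add_le_add hA1 (mul_le_mul_of_nonneg_left hB1 (by positivity))
    have h2 : q ≤ 4 ^ a * K ^ e * n₁ ^ a + n₂ * (4 ^ b' * K ^ e * n₁ ^ b') := by
      exact_mod_cast hqle.trans h1
    refine h2.trans ?_
    have h3 : n₁ ^ a ≤ n₁ ^ (a + 16) := Nat.pow_le_pow_right (by omega) (by omega)
    have h4 : n₂ * n₁ ^ b' ≤ n₁ ^ (a + 16) := by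
      calc n₂ * n₁ ^ b' ≤ n₁ ^ (16 * e + 16) * n₁ ^ b' := Nat.mul_le_mul_right _ hup
        _ = n₁ ^ (a + 16) := by rw [← pow_add]; congr 1; omega
    have h5 : 4 ^ b' ≤ 4 ^ a := Nat.pow_le_pow_right (by norm_num) (by omega)
    have h6 : 4 ^ a ≤ (4 ^ (17 * d)) ^ e := by
      rw [← pow_mul]; exact Nat.pow_le_pow_right (by norm_num) ha17
    have h7 : 2 ≤ 2 ^ e := Nat.le_self_pow (by omega) 2
    calc 4 ^ a * K ^ e * n₁ ^ a + n₂ * (4 ^ b' * K ^ e * n₁ ^ b')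
        = 4 ^ a * K ^ e * n₁ ^ a + 4 ^ b' * K ^ e * (n₂ * n₁ ^ b') := by ring
      _ ≤ 4 ^ a * K ^ e * n₁ ^ (a + 16) + 4 ^ a * K ^ e * n₁ ^ (a + 16) := by gcongr
      _ = 2 * 4 ^ a * K ^ e * n₁ ^ (a + 16) := by ring
      _ ≤ 2 ^ e * (4 ^ (17 * d)) ^ e * K ^ e * n₁ ^ (a + 16) := by gcongr
      _ = _ := by rw [hC₁, mul_pow, mul_pow]
  have hlowq : n₁ ^ (d * (16 * e - k)) ≤ (C₂ ^ 16) ^ e * q := by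
    rw [← pow_mul]
    rcases le_total m₂ ((m₁ - δ) * (16 * e - k)) with h | h
    · have hqe : q = p ^ m₂ := by rw [hq, ht, min_eq_left h]
      rw [hqe]
      calc n₁ ^ (d * (16 * e - k)) ≤ n₁ ^ (16 * e * d) := by
            refine Nat.pow_le_pow_right (by omega) ?_
            rw [mul_comm]; exact Nat.mul_le_mul_right _ (Nat.sub_le _ _)
        _ = (n₁ ^ (16 * e)) ^ d := pow_mul _ _ _
        _ ≤ n₂ ^ d := Nat.pow_le_pow_left hlow d
        _ ≤ 2 * B₀ * p ^ m₂ := hg2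
        _ ≤ C₂ ^ (16 * e) * p ^ m₂ := by
            refine Nat.mul_le_mul_right _ (hC₂B.trans (Nat.le_self_pow (by omega) _))
    · have hqe : q = (p ^ (m₁ - δ)) ^ (16 * e - k) := by rw [hq, ht, min_eq_right h, pow_mul]
      rw [hqe, pow_mul]
      have h1 : n₁ ^ d ≤ C₂ * p ^ (m₁ - δ) := by
        refine hg1.trans ?_
        rw [hC₂, mul_assoc (2 * B₀), ← pow_add]
        exact Nat.mul_le_mul_left _ (Nat.pow_le_pow_right hp.pos (by omega))
      calc (n₁ ^ d) ^ (16 * e - k) ≤ (C₂ * p ^ (m₁ - δ)) ^ (16 * e - k) :=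
            Nat.pow_le_pow_left h1 _
        _ = C₂ ^ (16 * e - k) * (p ^ (m₁ - δ)) ^ (16 * e - k) := mul_pow _ _ _
        _ ≤ _ := Nat.mul_le_mul_right _ (Nat.pow_le_pow_right hC₂1 (Nat.sub_le _ _))
  have hexp : a + 16 + e ≤ d * (16 * e - k) := by
    have h1 : d * (14 * e - d) ≤ d * (16 * e - k) := Nat.mul_le_mul_left _ (by omega)
    refine le_trans ?_ h1
    have h2 : d * (14 * e - d) = 14 * (d * e) - d ^ 2 := by
      rw [Nat.mul_sub]; congr 1 <;> ring
    omega
  have hfin : n₁ ^ e * n₁ ^ (a + 16) ≤ (C₁ * C₂ ^ 16) ^ e * n₁ ^ (a + 16) := by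
    calc n₁ ^ e * n₁ ^ (a + 16) = n₁ ^ (a + 16 + e) := by rw [← pow_add, add_comm]
      _ ≤ n₁ ^ (d * (16 * e - k)) := Nat.pow_le_pow_right (by omega) hexp
      _ ≤ (C₂ ^ 16) ^ e * q := hlowq
      _ ≤ (C₂ ^ 16) ^ e * (C₁ ^ e * n₁ ^ (a + 16)) := Nat.mul_le_mul_left _ hqN
      _ = _ := by rw [mul_pow]; ring
  have hfin2 := Nat.le_of_mul_le_mul_right hfin (by positivity)
  have hfin3 := (Nat.pow_le_pow_iff_left (by omega : e ≠ 0)).1 hfin2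
  omega

lemma clear_denoms (Q : ℚ[X]) : ∃ (L : ℕ) (Q' : ℤ[X]), 0 < L ∧
    Q'.map (Int.castRingHom ℚ) = C (L : ℚ) * Q := by
  obtain ⟨b, hbm, hb⟩ := IsLocalization.integerNormalization_spec (nonZeroDivisors ℤ) Q
  have hb0 : (b : ℤ) ≠ 0 := nonZeroDivisors.ne_zero hbm
  refine ⟨(b : ℤ).natAbs ^ 2, C (b : ℤ) * IsLocalization.integerNormalization (nonZeroDivisors ℤ) Q,
    pow_pos (Int.natAbs_pos.2 hb0) 2, ?_⟩
  rw [Polynomial.map_mul, map_C]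
  have h2 : Int.castRingHom ℚ = algebraMap ℤ ℚ := rfl
  rw [h2, hb]
  have h3 : (((b : ℤ).natAbs ^ 2 : ℕ) : ℚ) = (b : ℤ) * (b : ℤ) := by
    have : (((b : ℤ).natAbs ^ 2 : ℕ) : ℤ) = (b : ℤ) * (b : ℤ) := by
      push_cast; rw [sq_abs, sq]
    have h4 := congrArg (Int.cast (R := ℚ)) this
    rw [Int.cast_natCast, Int.cast_mul] at h4
    exact h4
  rw [h3, C_mul, mul_assoc]
  congr 1
  ext i
  simp

lemma thue_finite (p : ℕ) (hp : p.Prime) (g : ℤ[X]) (hg : g.Monic) (hd : 2 ≤ g.natDegree)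
    (hsep : (g.map (Int.castRingHom ℚ)).Separable) (B₀ : ℕ) (hB₀ : 1 ≤ B₀) :
    {n : ℕ | ∃ m : ℕ, (p : ℤ) ^ m ∣ g.eval (n : ℤ) ∧ g.eval (n : ℤ) ≠ 0 ∧
      |g.eval (n : ℤ)| ≤ B₀ * (p : ℤ) ^ m}.Finite := by
  have hsepC : (g.map (Int.castRingHom ℂ)).Separable := by
    have := hsep.map (f := algebraMap ℚ ℂ)
    rw [Polynomial.map_map] at this
    rwa [RingHom.ext_int ((algebraMap ℚ ℂ).comp (Int.castRingHom ℚ)) (Int.castRingHom ℂ)] at this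
  obtain ⟨u, v, huv⟩ := hsep
  obtain ⟨L₁, u', hL₁, hu'⟩ := clear_denoms u
  obtain ⟨L₂, v', hL₂, hv'⟩ := clear_denoms v
  have hinj : Function.Injective (Int.castRingHom ℚ) := Int.cast_injective
  obtain ⟨δ, hδ⟩ := hensel p hp g ((L₁ : ℤ) * L₂) (by positivity)
    (C (L₂ : ℤ) * u') (C (L₁ : ℤ) * v') (by
      apply Polynomial.map_injective _ hinj
      rw [derivative_map] at huv
      simp only [Polynomial.map_add, Polynomial.map_mul, map_C, hu', hv', map_mul]
      simp only [map_natCast]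
      linear_combination ((L₁ : ℚ[X]) * (L₂ : ℚ[X])) * huv)
  obtain ⟨N₁, hN₁⟩ := thue_step p hp g hg hd hsepC B₀ hB₀ δ hδ
  set S := {n : ℕ | ∃ m : ℕ, (p : ℤ) ^ m ∣ g.eval (n : ℤ) ∧ g.eval (n : ℤ) ≠ 0 ∧
      |g.eval (n : ℤ)| ≤ B₀ * (p : ℤ) ^ m} with hS
  have hpos : 0 < p ^ δ := pow_pos hp.pos _
  have hclass : ∀ r : ℕ, {n ∈ S | n % p ^ δ = r}.Finite := by
    intro r
    by_contra hinf
    have hinf : {n ∈ S | n % p ^ δ = r}.Infinite := hinf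
    obtain ⟨n₁, ⟨⟨m₁, h1, h2, h3⟩, hr₁⟩, hgt⟩ := hinf.exists_gt N₁
    obtain ⟨N₂, hN₂⟩ := hN₁ n₁ m₁ hgt h1 h2 h3
    obtain ⟨n₂, ⟨⟨m₂, h1', h2', h3'⟩, hr₂⟩, hgt₂⟩ := hinf.exists_gt N₂
    have := hN₂ n₂ m₂ h1' h2' h3' (by
      have h : n₁ ≡ n₂ [MOD p ^ δ] := by rw [Nat.ModEq, hr₁, hr₂]
      have := (Nat.modEq_iff_dvd).1 h
      exact_mod_cast this)
    omega
  refine ((Set.finite_lt_nat (p ^ δ)).biUnion fun r _ => hclass r).subset fun n hn => ?_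
  simp only [Set.mem_iUnion]
  exact ⟨n % p ^ δ, Nat.mod_lt _ hpos, hn, rfl⟩

lemma scale_monic (f : ℚ[X]) (hf : f.Monic) (hsep : f.Separable) :
    ∃ (l : ℕ) (g : ℤ[X]), 0 < l ∧ g.Monic ∧ g.natDegree = f.natDegree ∧
      (g.map (Int.castRingHom ℚ)).Separable ∧
      ∀ n : ℕ, ((g.eval ((l * n : ℕ) : ℤ) : ℤ) : ℚ) = (l : ℚ) ^ f.natDegree * f.eval (n : ℚ) := by
  obtain ⟨l, f', hl, hf'⟩ := clear_denoms f
  have hl0 : (l : ℚ) ≠ 0 := by positivity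
  set G := scaleRoots f (l : ℚ) with hG
  have hGm : G.Monic := (monic_scaleRoots_iff _).2 hf
  have hlift : G ∈ lifts (Int.castRingHom ℚ) := by
    rw [lifts_iff_coeff_lifts]
    intro i
    rw [hG, coeff_scaleRoots]
    rcases lt_trichotomy i f.natDegree with h | h | h
    · refine ⟨f'.coeff i * (l : ℤ) ^ (f.natDegree - i - 1), ?_⟩
      have h1 := congrArg (fun q => coeff q i) hf'
      simp only [coeff_map, coeff_C_mul] at h1
      rw [map_mul, h1, map_pow, map_natCast]
      obtain ⟨j, hj⟩ : ∃ j, f.natDegree - i = j + 1 := ⟨f.natDegree - i - 1, by omega⟩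
      rw [hj, Nat.add_sub_cancel]; ring
    · refine ⟨1, ?_⟩
      have : f.coeff f.natDegree = 1 := hf
      rw [h, this]; simp
    · refine ⟨0, ?_⟩
      rw [coeff_eq_zero_of_natDegree_lt h]; simp
  obtain ⟨g, hgG, hgd, hgm⟩ := lifts_and_natDegree_eq_and_monic hlift hGm
  have hev : ∀ r : ℚ, G.eval ((l : ℚ) * r) = (l : ℚ) ^ f.natDegree * f.eval r := by
    intro r
    have := scaleRoots_eval₂_mul (RingHom.id ℚ) (p := f) r (l : ℚ)
    simpa [eval₂_id] using this
  refine ⟨l, g, hl, hgm, by rw [hgd, hG, natDegree_scaleRoots], ?_, ?_⟩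
  · rw [hgG]
    have hGc : G = C ((l : ℚ) ^ f.natDegree) * f.comp (C (l : ℚ)⁻¹ * X) := by
      apply Polynomial.funext
      intro r
      have := hev ((l : ℚ)⁻¹ * r)
      rw [mul_inv_cancel_left₀ hl0] at this
      rw [this]; simp
    have hco : IsCoprime (f.comp (C (l : ℚ)⁻¹ * X)) ((derivative f).comp (C (l : ℚ)⁻¹ * X)) := by
      have := IsCoprime.map hsep (compRingHom (C (l : ℚ)⁻¹ * X))
      simpa using this
    rw [hGc, separable_def, derivative_C_mul, derivative_comp]
    have hu1 : IsUnit (C ((l : ℚ) ^ f.natDegree)) := isUnit_C.2 (IsUnit.mk0 _ (pow_ne_zero _ hl0))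
    have hu2 : IsUnit (C (l : ℚ)⁻¹) := isUnit_C.2 (IsUnit.mk0 _ (inv_ne_zero hl0))
    rw [isCoprime_mul_unit_left_left hu1, isCoprime_mul_unit_left_right hu1]
    have : derivative (C (l : ℚ)⁻¹ * X) = C (l : ℚ)⁻¹ := by simp
    rw [this, isCoprime_mul_unit_left_right hu2]
    exact hco
  · intro n
    rw [← hev, ← hgG]
    have := eval_intCast_map (Int.castRingHom ℚ) g ((l * n : ℕ) : ℤ)
    push_cast at this ⊢
    exact this.symm

lemma finite_case (p : ℕ) (hp : p.Prime) (Q f : ℚ[X]) (hf : f.Monic) (hsep : f.Separable)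
    (hd : 2 ≤ f.natDegree) (hfQ : f ∣ Q) (a : ℚ) (ha : a ≠ 0) :
    {n : ℕ | ∃ M : ℕ, Q.eval (n : ℚ) = a * (p : ℚ) ^ M}.Finite := by
  obtain ⟨h, rfl⟩ := hfQ
  obtain ⟨l, g, hl, hgm, hgd, hgs, hge⟩ := scale_monic f hf hsep
  obtain ⟨L, h', hL, hh'⟩ := clear_denoms h
  set D : ℤ := (l : ℤ) ^ f.natDegree * L * a.num with hD
  have hD0 : D ≠ 0 := by
    have : a.num ≠ 0 := Rat.num_ne_zero.2 ha
    rw [hD]; positivity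
  have hfin := thue_finite p hp g hgm (by omega) hgs D.natAbs (Int.natAbs_pos.2 hD0)
  have hinj : Function.Injective (fun n : ℕ => l * n) := fun x y hxy =>
    Nat.eq_of_mul_eq_mul_left hl hxy
  refine (hfin.preimage hinj.injOn).subset ?_
  rintro n ⟨M, hM⟩
  have hp' : Prime (p : ℤ) := Nat.prime_iff_prime_int.1 hp
  have hp0 : (p : ℤ) ≠ 0 := hp'.ne_zero
  set G := g.eval ((l * n : ℕ) : ℤ) with hG
  have hdvd : G ∣ D * (p : ℤ) ^ M := by
    refine ⟨h'.eval (n : ℤ) * a.den, ?_⟩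
    have h1 : ((h'.eval (n : ℤ) : ℤ) : ℚ) = L * h.eval (n : ℚ) := by
      have := eval_intCast_map (Int.castRingHom ℚ) h' (n : ℤ)
      rw [hh'] at this
      simpa using this.symm
    have h2 : (a.num : ℚ) = a * a.den := (Rat.mul_den_eq_num a).symm
    have : ((D * (p : ℤ) ^ M : ℤ) : ℚ) = ((G * (h'.eval (n : ℤ) * a.den) : ℤ) : ℚ) := by
      rw [hD]
      push_cast
      rw [hge, h1, h2]
      rw [eval_mul] at hM
      linear_combination (-(l : ℚ) ^ f.natDegree * L * a.den) * hM
    exact_mod_cast this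
  have hG0 : G ≠ 0 := by
    intro h0
    rw [h0, zero_dvd_iff] at hdvd
    exact (mul_ne_zero hD0 (pow_ne_zero _ hp0)) hdvd
  have hfm : FiniteMultiplicity (p : ℤ) G :=
    Int.finiteMultiplicity_iff.2 ⟨by simpa using hp.ne_one, hG0⟩
  obtain ⟨c, hGc, hc⟩ := hfm.exists_eq_pow_mul_and_not_dvd
  generalize multiplicity (p : ℤ) G = m at hGc
  refine ⟨m, ⟨c, hGc⟩, hG0, ?_⟩
  have hcD : c ∣ D := by
    have h1 : c ∣ D * (p : ℤ) ^ M := (Dvd.intro_left _ hGc.symm).trans hdvd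
    have h2 : IsCoprime c ((p : ℤ) ^ M) :=
      (((Irreducible.coprime_iff_not_dvd hp'.irreducible).2 hc).symm).pow_right
    exact h2.dvd_of_dvd_mul_right h1
  have h3 : |c| ≤ |D| := Int.le_of_dvd (abs_pos.2 hD0) ((abs_dvd_abs _ _).2 hcD)
  change |G| ≤ _
  rw [hGc, abs_mul, abs_of_nonneg (by positivity : (0 : ℤ) ≤ (p : ℤ) ^ m), mul_comm,
    Int.natCast_natAbs]
  exact mul_le_mul_of_nonneg_right h3 (by positivity)

lemma radical_cases (Q : ℚ[X]) (hd : 1 ≤ Q.natDegree) :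
    (∃ f : ℚ[X], f.Monic ∧ f.Separable ∧ 2 ≤ f.natDegree ∧ f ∣ Q) ∨
    (∃ c r : ℚ, c ≠ 0 ∧ Q = C c * (X - C r) ^ Q.natDegree) := by
  classical
  have hQ0 : Q ≠ 0 := by rintro rfl; simp at hd
  set f := UniqueFactorizationMonoid.radical Q with hf
  have hsq : Squarefree f := UniqueFactorizationMonoid.squarefree_radical
  have hf0 : f ≠ 0 := UniqueFactorizationMonoid.radical_ne_zero
  have hfQ : f ∣ Q := UniqueFactorizationMonoid.radical_dvd_self
  obtain ⟨n, hn⟩ := UniqueFactorizationMonoid.exists_dvd_radical_self_pow hQ0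
  rw [← hf] at hn
  have hlc : f.leadingCoeff⁻¹ ≠ 0 := inv_ne_zero (leadingCoeff_ne_zero.2 hf0)
  have hu : IsUnit (C f.leadingCoeff⁻¹) := isUnit_C.2 (IsUnit.mk0 _ hlc)
  set f₁ := f * C f.leadingCoeff⁻¹ with hf₁
  have hm : f₁.Monic := monic_mul_leadingCoeff_inv hf0
  have hass : Associated f f₁ := by
    obtain ⟨u, hu⟩ := hu
    exact ⟨u, by rw [hu]⟩
  have hdeg : f₁.natDegree = f.natDegree := natDegree_mul_C hlc
  by_cases h2 : 2 ≤ f.natDegree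
  · left
    refine ⟨f₁, hm, ?_, by omega, hass.symm.dvd.trans hfQ⟩
    exact PerfectField.separable_iff_squarefree.2 (hsq.squarefree_of_dvd hass.symm.dvd)
  · right
    have hn1 : Q ∣ f₁ ^ n := hn.trans (pow_dvd_pow_of_dvd hass.dvd n)
    have h1 : f₁.natDegree = 1 := by
      by_contra hne
      have h0 : f₁.natDegree = 0 := by omega
      rw [hm.natDegree_eq_zero.1 h0, one_pow] at hn1
      have := natDegree_eq_zero_of_isUnit (isUnit_of_dvd_one hn1)
      omega
    obtain ⟨r, hr⟩ : ∃ r, f₁ = X - C r := by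
      refine ⟨-f₁.coeff 0, ?_⟩
      rw [C_neg, sub_neg_eq_add]
      exact hm.eq_X_add_C h1
    rw [hr] at hn1
    obtain ⟨i, hi, hi2⟩ := (dvd_prime_pow (prime_X_sub_C r) n).1 hn1
    obtain ⟨u, hu⟩ := hi2.symm
    obtain ⟨c, hc, hcu⟩ := isUnit_iff.1 u.isUnit
    have hQe : Q = C c * (X - C r) ^ i := by rw [← hu, hcu, mul_comm]
    have hdi : Q.natDegree = i := by
      rw [hQe, natDegree_C_mul hc.ne_zero, natDegree_pow, natDegree_X_sub_C, mul_one]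
    exact ⟨c, r, hc.ne_zero, by rw [hdi]; exact hQe⟩

lemma finUnion_of_finite {p : ℕ} {ι : Type*} {s : Set ι} (hs : s.Finite) (F : ι → Set ℕ)
    (hF : ∀ i ∈ s, IsPArithSeqNat p (F i)) (S : Set ℕ) (hS : S = ⋃ i ∈ s, F i) :
    IsFinUnionPArithNat p S := by
  have := hs.fintype
  let e := Fintype.equivFin s
  refine ⟨Fintype.card s, fun j => F (e.symm j).1, fun j => hF _ (e.symm j).2, ?_⟩
  rw [hS, Set.biUnion_eq_iUnion]
  exact (e.symm.surjective.iUnion_comp (fun i : s => F i.1)).symm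

lemma finUnion_finite {p : ℕ} {S : Set ℕ} (hS : S.Finite) : IsFinUnionPArithNat p S := by
  refine finUnion_of_finite hS (fun n => {n}) (fun n _ => ⟨0, n, 0, ?_⟩) S (by simp)
  ext m
  simp

theorem stmt6 (p : ℕ) (hp : p.Prime) (k : ℕ) (a b : ℚ)
    (P : Polynomial ℚ) (d : ℕ) (hd : P.natDegree = d) (hd1 : 1 ≤ d) :
    IsFinUnionPArithNat p
      {n : ℕ | ∃ m : ℕ, P.eval (n : ℚ) = b + a * (p : ℚ) ^ (m * k)} := by
  set Q := P - C b with hQ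
  have hQd : Q.natDegree = d := by rw [hQ, natDegree_sub_C, hd]
  have hQ0 : Q ≠ 0 := by rintro h; rw [h] at hQd; simp at hQd; omega
  have hT : {n : ℕ | ∃ m : ℕ, P.eval (n : ℚ) = b + a * (p : ℚ) ^ (m * k)}
      = {n : ℕ | ∃ m : ℕ, Q.eval (n : ℚ) = a * (p : ℚ) ^ (m * k)} := by
    ext n
    simp only [Set.mem_ofPred_eq, hQ, eval_sub, eval_C, sub_eq_iff_eq_add']
  rw [hT]
  have hp0 : (p : ℚ) ≠ 0 := by exact_mod_cast hp.ne_zero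
  by_cases ha : a = 0
  · apply finUnion_finite
    have h1 : {x : ℚ | Q.IsRoot x}.Finite := finite_setOf_isRoot hQ0
    refine (h1.preimage (f := fun n : ℕ => (n : ℚ)) Nat.cast_injective.injOn).subset ?_
    rintro n ⟨m, hm⟩
    simpa [ha] using hm
  rcases radical_cases Q (by omega) with ⟨f, hfm, hfs, hfd, hfQ⟩ | ⟨c, r, hc, hQe⟩
  · apply finUnion_finite
    refine (finite_case p hp Q f hfm hfs hfd hfQ a ha).subset ?_
    rintro n ⟨m, hm⟩
    exact ⟨m * k, hm⟩
  · rw [hQd] at hQe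
    have hfin : ∀ s : ℕ, {v : ℚ | c * v ^ d = a * (p : ℚ) ^ (s * k)}.Finite := by
      intro s
      have hne : C c * X ^ d - C (a * (p : ℚ) ^ (s * k)) ≠ 0 := by
        intro h
        have h2 : (C c * X ^ d - C (a * (p : ℚ) ^ (s * k))).natDegree = d := by
          rw [natDegree_sub_C, natDegree_C_mul_X_pow _ _ hc]
        rw [h] at h2; simp at h2; omega
      refine (finite_setOf_isRoot hne).subset ?_
      intro v hv
      have hv' : c * v ^ d = a * (p : ℚ) ^ (s * k) := hv
      simp [hv']
    have hfin2 : {sv : ℕ × ℚ | sv.1 < d ∧ c * sv.2 ^ d = a * (p : ℚ) ^ (sv.1 * k)}.Finite := by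
      refine ((Set.finite_lt_nat d).biUnion fun s _ => (hfin s).image (Prod.mk s)).subset ?_
      rintro ⟨s, v⟩ ⟨h1, h2⟩
      simp only [Set.mem_iUnion]
      exact ⟨s, h1, v, h2, rfl⟩
    refine finUnion_of_finite hfin2
      (fun sv => {n : ℕ | ∃ j : ℕ, (n : ℚ) = sv.2 * (p : ℚ) ^ (k * j) + r})
      (fun sv _ => ⟨sv.2, r, k, rfl⟩) _ ?_
    have hev : ∀ x : ℚ, Q.eval x = c * (x - r) ^ d := by
      intro x; rw [hQe]; simp
    ext n
    simp only [Set.mem_ofPred_eq, Set.mem_iUnion, hev]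
    constructor
    · rintro ⟨m, hm⟩
      have hpj : (p : ℚ) ^ (k * (m / d)) ≠ 0 := pow_ne_zero _ hp0
      refine ⟨(m % d, (n - r) / (p : ℚ) ^ (k * (m / d))), ⟨Nat.mod_lt _ (by omega), ?_⟩, m / d, ?_⟩
      · simp only
        rw [div_pow, ← mul_div_assoc, hm, div_eq_iff (pow_ne_zero _ hpj), ← pow_mul, mul_assoc,
          ← pow_add]
        congr 2
        conv_lhs => rw [← Nat.mod_add_div m d]
        ring
      · simp only
        rw [div_mul_cancel₀ _ hpj]; ring
    · rintro ⟨⟨s, v⟩, ⟨_, hsv⟩, j, hj⟩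
      simp only at hsv hj
      refine ⟨s + d * j, ?_⟩
      rw [hj, add_sub_cancel_right, mul_pow, ← mul_assoc, hsv, ← pow_mul, mul_assoc, ← pow_add]
      congr 2
      ring
end

section
/- Let G be a finitely generated abelian group, Φ₀: G → G a homomorphism satisfying a monic integer linear recurrence Φ₀^ℓ + c_{ℓ-1}Φ₀^{ℓ-1} + ... + c₀·id = 0, y, α ∈ G, Φ(x) = y + Φ₀(x), R ∈ G, and H ≤ G a subgroup. Then S = {n ∈ ℕ₀ : Φ^n(α) ∈ R + H} is a finite union of arithmetic progressions. -/
/-- An arithmetic progression of natural numbers `{m·k + ℓ' : k ∈ ℕ₀}`. -/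
def IsAPNat (S : Set ℕ) : Prop :=
  ∃ m ℓ' : ℕ, S = {n : ℕ | ∃ j : ℕ, n = m * j + ℓ'}


lemma sml_fact_dvd (p : ℕ) [hp : Fact p.Prime] (j : ℕ) : ∃ u : ℤ_[p], u * (j.factorial : ℤ_[p]) = (p : ℤ_[p]) ^ j := by
  have hv : padicValNat p j.factorial ≤ j := by
    have h := sub_one_mul_padicValNat_factorial (p := p) j
    have h2 := hp.out.two_le
    have : 1 * padicValNat p j.factorial ≤ (p - 1) * padicValNat p j.factorial :=
      Nat.mul_le_mul_right _ (by omega)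
    omega
  obtain ⟨m, hm⟩ := pow_padicValNat_dvd (p := p) (n := j.factorial)
  have hpm : ¬ p ∣ m := by
    rintro ⟨q, rfl⟩
    apply pow_succ_padicValNat_not_dvd (p := p) (Nat.factorial_ne_zero j)
    exact ⟨q, by rw [pow_succ, mul_assoc]; exact hm⟩
  have hu : IsUnit (m : ℤ_[p]) := by
    rw [PadicInt.isUnit_iff]
    exact PadicInt.norm_natCast_eq_one_iff.2 ((Nat.Prime.coprime_iff_not_dvd hp.out).2 hpm)
  obtain ⟨w, hw⟩ := hu
  refine ⟨(p : ℤ_[p]) ^ (j - padicValNat p j.factorial) * (↑w⁻¹ : ℤ_[p]), ?_⟩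
  generalize padicValNat p j.factorial = v at *
  rw [hm]
  push_cast
  rw [← hw]
  calc _ = (p : ℤ_[p]) ^ (j - v) * (p : ℤ_[p]) ^ v * ((↑w⁻¹ : ℤ_[p]) * w) := by ring
    _ = _ := by rw [Units.inv_mul, mul_one, ← pow_add, Nat.sub_add_cancel hv]

open Polynomial in
lemma sml_core (p : ℕ) [hp : Fact p.Prime] (b d : ℕ → ℤ)
    (hb : ∀ n, b n = ∑ k ∈ Finset.range (n + 1), (n.choose k : ℤ) * (p : ℤ) ^ (2 * k) * d k)
    (hinf : {n | b n = 0}.Infinite) (n₀ : ℕ) : b n₀ = 0 := by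
  classical
  choose u hu using sml_fact_dvd p
  have key : ∀ s : ℕ, (p : ℤ) ^ s ∣ b n₀ := by
    intro s
    obtain ⟨T, hT, hTs⟩ := hinf.exists_subset_card_eq s
    obtain ⟨N, hN⟩ : ∃ N, ∀ n ∈ insert n₀ T, n ≤ N :=
      ⟨(insert n₀ T).sup id, fun n hn => Finset.le_sup (f := id) hn⟩
    let P : ℤ_[p][X] := ∑ j ∈ Finset.range (N + 1),
      C ((d j : ℤ_[p]) * u j * (p : ℤ_[p]) ^ j) * descPochhammer ℤ_[p] j
    have hP : ∀ n ≤ N, P.eval (n : ℤ_[p]) = (b n : ℤ_[p]) := by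
      intro n hn
      rw [hb]
      have : ∑ k ∈ Finset.range (n + 1), (n.choose k : ℤ) * (p : ℤ) ^ (2 * k) * d k
          = ∑ k ∈ Finset.range (N + 1), (n.choose k : ℤ) * (p : ℤ) ^ (2 * k) * d k := by
        apply Finset.sum_subset
        · intro x hx
          simp only [Finset.mem_range] at *
          omega
        · intro x _ hx
          simp only [Finset.mem_range, not_lt] at hx
          rw [Nat.choose_eq_zero_of_lt (by omega)]
          simp
      rw [this]
      simp only [P, eval_finsetSum, eval_mul, eval_C, descPochhammer_eval_eq_descFactorial,
        Nat.descFactorial_eq_factorial_mul_choose]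
      push_cast
      refine Finset.sum_congr rfl fun j _ => ?_
      calc _ = (d j : ℤ_[p]) * (p : ℤ_[p]) ^ j * (u j * (j.factorial : ℤ_[p])) * (n.choose j : ℤ_[p]) := by ring
        _ = _ := by rw [hu]; ring
    let D : ℤ_[p][X] := ∏ t ∈ T, (X - C (t : ℤ_[p]))
    have hD : D.Monic := monic_prod_of_monic _ _ fun t _ => monic_X_sub_C _
    have hDdeg : D.natDegree = s := by
      rw [natDegree_prod_of_monic _ _ fun t _ => monic_X_sub_C _]
      simp only [natDegree_X_sub_C, Finset.sum_const, hTs, smul_eq_mul, mul_one]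
    have hDP : D ∣ P := by
      by_cases hP0 : P = 0
      · rw [hP0]; exact dvd_zero _
      have h := (Multiset.prod_X_sub_C_dvd_iff_le_roots hP0 (T.val.map (fun t : ℕ => (t : ℤ_[p])))).2 ?_
      · rw [Multiset.map_map] at h
        exact h
      · rw [Multiset.le_iff_subset]
        · intro x hx
          obtain ⟨t, ht, rfl⟩ := Multiset.mem_map.1 hx
          rw [mem_roots hP0, IsRoot.def, hP t (hN t (Finset.mem_insert_of_mem ht))]
          have : b t = 0 := hT ht
          simp [this]
        · exact Multiset.Nodup.map Nat.cast_injective T.nodup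
    let φ : ℤ_[p] →+* ZMod (p ^ s) := PadicInt.toZModPow s
    have hφ : P.map φ = 0 := by
      by_contra hne
      have : Nontrivial (ZMod (p ^ s)) := by
        by_contra hn
        rw [not_nontrivial_iff_subsingleton] at hn
        exact hne (Subsingleton.elim _ _)
      refine (hD.map φ).not_dvd_of_degree_lt hne ?_ (Polynomial.map_dvd φ hDP)
      rw [degree_eq_natDegree (hD.map φ).ne_zero, hD.natDegree_map, hDdeg]
      simp only [P, Polynomial.map_sum]
      refine lt_of_le_of_lt (degree_sum_le _ _) ?_
      rw [Finset.sup_lt_iff (WithBot.bot_lt_coe _)]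
      intro j _
      by_cases hj : j < s
      · rw [Polynomial.map_mul, map_C]
        refine lt_of_le_of_lt ((degree_mul_le _ _).trans (add_le_add_left degree_C_le _)) ?_
        rw [zero_add]
        refine lt_of_le_of_lt degree_map_le ?_
        refine lt_of_le_of_lt degree_le_natDegree ?_
        rw [descPochhammer_natDegree]
        exact_mod_cast hj
      · have : φ ((p : ℤ_[p]) ^ j) = 0 := by
          have h1 : φ ((p : ℤ_[p]) ^ j) = ((p ^ j : ℕ) : ZMod (p ^ s)) := by simp
          rw [h1, ZMod.natCast_eq_zero_iff]
          exact pow_dvd_pow _ (by omega)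
        rw [Polynomial.map_mul, map_C, map_mul, this]
        simp
    have h1 : φ (P.eval (n₀ : ℤ_[p])) = 0 := by
      rw [← eval_map_apply, hφ, eval_zero]
    rw [hP n₀ (hN n₀ (Finset.mem_insert_self _ _)), map_intCast,
      ZMod.intCast_zmod_eq_zero_iff_dvd] at h1
    exact_mod_cast h1
  by_contra hne
  have h := Int.eq_zero_of_abs_lt_dvd (key (b n₀).natAbs) ?_
  · exact hne h
  · have := Nat.lt_pow_self hp.out.one_lt (n := (b n₀).natAbs)
    rw [Int.abs_eq_natAbs]
    exact_mod_cast this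

def SmlEP (S : Set ℕ) : Prop := ∃ d N : ℕ, 0 < d ∧ ∀ n ≥ N, (n ∈ S ↔ n + d ∈ S)

lemma SmlEP.mul {S : Set ℕ} {d N : ℕ} (h : ∀ n ≥ N, (n ∈ S ↔ n + d ∈ S)) (k : ℕ) :
    ∀ n ≥ N, (n ∈ S ↔ n + d * k ∈ S) := by
  induction k with
  | zero => simp
  | succ k ih =>
    intro n hn
    rw [ih n hn, h _ (by omega)]
    ring_nf

lemma SmlEP.inter {S T : Set ℕ} (hS : SmlEP S) (hT : SmlEP T) : SmlEP (S ∩ T) := by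
  obtain ⟨d, N, hd, h⟩ := hS
  obtain ⟨d', N', hd', h'⟩ := hT
  refine ⟨d * d', max N N', by positivity, fun n hn => ?_⟩
  have h1 := SmlEP.mul h d' n (le_trans (le_max_left _ _) hn)
  have h2 := SmlEP.mul h' d n (le_trans (le_max_right _ _) hn)
  rw [mul_comm d' d] at h2
  simp only [Set.mem_inter_iff]
  rw [h1, h2]

lemma SmlEP.univ : SmlEP Set.univ := ⟨1, 0, one_pos, by simp⟩

lemma SmlEP.iInter {ι : Type*} [Finite ι] (S : ι → Set ℕ) (h : ∀ i, SmlEP (S i)) :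
    SmlEP (⋂ i, S i) := by
  classical
  cases nonempty_fintype ι
  have : ∀ s : Finset ι, SmlEP (⋂ i ∈ s, S i) := by
    intro s
    induction s using Finset.induction_on with
    | empty => simpa using SmlEP.univ
    | insert a s _ ih =>
      rw [Finset.set_biInter_insert]
      exact (h a).inter ih
  simpa using this Finset.univ

lemma SmlEP.shift {S : Set ℕ} (k : ℕ) (h : SmlEP {n | n + k ∈ S}) : SmlEP S := by
  obtain ⟨d, N, hd, h⟩ := h
  refine ⟨d, N + k, hd, fun n hn => ?_⟩
  have := h (n - k) (by omega)
  simp only [Set.mem_ofPred_eq] at this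
  rwa [Nat.sub_add_cancel (by omega), show n - k + d + k = n + d by omega] at this

lemma SmlEP.of_residues {S : Set ℕ} (e : ℕ) (he : 0 < e)
    (h : ∀ r < e, {n | r + e * n ∈ S}.Infinite → ∀ n, r + e * n ∈ S) : SmlEP S := by
  have : ∀ r : Fin e, ∃ N, ∀ n ≥ N, (r.1 + e * n ∈ S ↔ r.1 + e * (n + 1) ∈ S) := by
    intro r
    by_cases hi : {n | r.1 + e * n ∈ S}.Infinite
    · exact ⟨0, fun n _ => by simp [h r.1 r.2 hi n, h r.1 r.2 hi (n + 1)]⟩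
    · rw [Set.not_infinite] at hi
      obtain ⟨B, hB⟩ := hi.bddAbove
      refine ⟨B + 1, fun n hn => ?_⟩
      have h1 : ∀ m ≥ B + 1, r.1 + e * m ∉ S := by
        intro m hm hmem
        have := hB hmem
        omega
      simp [h1 n hn, h1 (n + 1) (by omega)]
  choose N hN using this
  refine ⟨e, e * (Finset.univ.sup N), he, fun n hn => ?_⟩
  have := hN ⟨n % e, Nat.mod_lt _ he⟩ (n / e) ?_
  · simp only [mul_add, mul_one] at this
    rwa [← add_assoc, Nat.mod_add_div] at this
  · refine le_trans (Finset.le_sup (Finset.mem_univ _)) ?_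
    rw [Nat.le_div_iff_mul_le he, mul_comm]
    exact hn

lemma sml_pow_eq (M : Type*) [AddCommGroup M] [Module.Finite ℤ M] [Module.Free ℤ M]
    (A : Module.End ℤ M) (hA : Function.Injective A) :
    ∃ p : ℕ, p.Prime ∧ ∃ e > 0, ∃ B : Module.End ℤ M, A ^ e = 1 + ((p : ℤ) ^ 2) • B := by
  classical
  let bs := Module.Free.chooseBasis ℤ M
  let E := LinearMap.toMatrixAlgEquiv bs
  have hdet : LinearMap.det A ≠ 0 := by
    intro h
    exact LinearMap.det_eq_zero_iff_ker_ne_bot.1 h (LinearMap.ker_eq_bot_of_injective hA)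
  have hdet' : (E A).det = LinearMap.det A := LinearMap.det_toMatrix bs A
  obtain ⟨p, hp1, hp⟩ := Nat.exists_infinite_primes ((E A).det.natAbs + 1)
  refine ⟨p, hp, ?_⟩
  let φ : ℤ →+* ZMod (p ^ 2) := Int.castRingHom _
  have : NeZero (p ^ 2) := ⟨pow_ne_zero _ hp.ne_zero⟩
  have hunit : IsUnit (φ.mapMatrix (E A)) := by
    rw [Matrix.isUnit_iff_isUnit_det, ← RingHom.map_det]
    have : IsCoprime (E A).det ((p ^ 2 : ℕ) : ℤ) := by
      rw [Int.isCoprime_iff_gcd_eq_one, Int.gcd, Int.natAbs_natCast]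
      apply Nat.Coprime.pow_right
      rw [Nat.coprime_comm, hp.coprime_iff_not_dvd]
      intro hd
      have := Nat.le_of_dvd (by rw [hdet']; exact Int.natAbs_pos.2 hdet) hd
      omega
    obtain ⟨x, y, hxy⟩ := this
    have h2 := congrArg φ hxy
    rw [map_add, map_mul, map_mul, map_one] at h2
    have h3 : φ ((p ^ 2 : ℕ) : ℤ) = 0 := by
      rw [map_natCast]; exact ZMod.natCast_self _
    rw [h3, mul_zero, add_zero] at h2
    exact IsUnit.of_mul_eq_one_right _ h2
  obtain ⟨w, hw⟩ := hunit
  obtain ⟨e, he, hwe⟩ := (isOfFinOrder_of_finite w).exists_pow_eq_one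
  have h1 : φ.mapMatrix (E A ^ e - 1) = 0 := by
    rw [map_sub, map_pow, ← hw, map_one, ← Units.val_pow_eq_pow_val, hwe]
    simp
  have h2 : ∀ i j, ∃ c, (E A ^ e - 1) i j = (p : ℤ) ^ 2 * c := by
    intro i j
    have : φ ((E A ^ e - 1) i j) = 0 := congrFun (congrFun h1 i) j
    have := (ZMod.intCast_zmod_eq_zero_iff_dvd _ _).1 this
    exact_mod_cast this
  choose c hc using h2
  refine ⟨e, he, E.symm (Matrix.of c), ?_⟩
  apply E.injective
  rw [map_pow, map_add, map_one, map_smul, AlgEquiv.apply_symm_apply, ← sub_eq_iff_eq_add']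
  ext i j
  rw [hc]
  rfl

lemma sml_inj (M : Type*) [AddCommGroup M] [Module.Finite ℤ M] [Module.Free ℤ M]
    (A : Module.End ℤ M) (hA : Function.Injective A) (f : M →ₗ[ℤ] ℤ) (v : M) :
    SmlEP {n | f ((A ^ n) v) = 0} := by
  obtain ⟨p, hp, e, he, B, hB⟩ := sml_pow_eq M A hA
  have := Fact.mk hp
  refine SmlEP.of_residues e he fun r _ hinf n => ?_
  refine sml_core p (fun n => f ((A ^ (r + e * n)) v)) (fun k => f ((B ^ k) ((A ^ r) v))) ?_ hinf n
  intro n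
  have hc : Commute (((p : ℤ) ^ 2) • B) 1 := Commute.one_right _
  rw [add_comm r, pow_add, pow_mul, hB, add_comm 1, hc.add_pow]
  simp only [one_pow, mul_one, Module.End.mul_apply, LinearMap.sum_apply, map_sum]
  refine Finset.sum_congr rfl fun k _ => ?_
  rw [smul_pow, ← pow_mul, Module.End.natCast_apply]
  simp only [LinearMap.smul_apply, map_smul, map_nsmul]
  simp [mul_assoc]

lemma sml_functional (M : Type*) [AddCommGroup M] [Module.Finite ℤ M] [Module.Free ℤ M]
    (A : Module.End ℤ M) (f : M →ₗ[ℤ] ℤ) (v : M) :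
    SmlEP {n | f ((A ^ n) v) = 0} := by
  obtain ⟨k, hk1, hk⟩ := ((Filter.eventually_ge_atTop 1).and
    (Module.End.eventually_disjoint_ker_pow_range_pow A)).exists
  let W := LinearMap.range (A ^ k)
  have hW : ∀ x ∈ W, A x ∈ W := by
    rintro x ⟨z, rfl⟩
    exact ⟨A z, by rw [← Module.End.mul_apply, ← Module.End.mul_apply, ← pow_succ, ← pow_succ']⟩
  let A' : Module.End ℤ W := A.restrict hW
  have hinj : Function.Injective A' := by
    rw [injective_iff_map_eq_zero]
    rintro ⟨x, hx⟩ h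
    have hAx : A x = 0 := congrArg Subtype.val h
    have hkx : x ∈ LinearMap.ker (A ^ k) := by
      rw [LinearMap.mem_ker, show k = (k - 1) + 1 by omega, pow_succ, Module.End.mul_apply, hAx,
        map_zero]
    exact Subtype.ext (Submodule.disjoint_def.1 hk x hkx hx)
  apply SmlEP.shift k
  convert sml_inj W A' hinj (f ∘ₗ W.subtype) ⟨(A ^ k) v, v, rfl⟩ using 1
  ext n
  have h1 : (A' ^ n) = (A ^ n).restrict _ := Module.End.pow_restrict n hW
  simp only [Set.mem_ofPred_eq, h1, LinearMap.comp_apply, Submodule.subtype_apply,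
    LinearMap.coe_restrict_apply, pow_add, Module.End.mul_apply]

lemma sml_finite (r : ℕ) (A : Module.End ℤ (Fin r → ℤ)) (T : Type*) [AddCommGroup T] [Finite T]
    (g : (Fin r → ℤ) →ₗ[ℤ] T) (v : Fin r → ℤ) : SmlEP {n | g ((A ^ n) v) = 0} := by
  have : Finite ((Fin r → ℤ) →ₗ[ℤ] T) :=
    Finite.of_equiv _ ((Pi.basisFun ℤ (Fin r)).constr ℤ).toEquiv
  obtain ⟨i, j, hij, h⟩ := Finite.exists_ne_map_eq_of_infinite (fun n : ℕ => g ∘ₗ (A ^ n))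
  wlog hlt : i < j generalizing i j
  · exact this j i hij.symm h.symm (by omega)
  refine ⟨j - i, i, by omega, fun n hn => ?_⟩
  have h1 : g ((A ^ n) v) = g ((A ^ (n + (j - i))) v) := by
    have := LinearMap.congr_fun h ((A ^ (n - i)) v)
    simp only [LinearMap.comp_apply, ← Module.End.mul_apply, ← pow_add] at this
    rwa [show i + (n - i) = n by omega, show j + (n - i) = n + (j - i) by omega] at this
  simp only [Set.mem_ofPred_eq, h1]

lemma sml_submodule (r : ℕ) (A : Module.End ℤ (Fin r → ℤ)) (N : Submodule ℤ (Fin r → ℤ))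
    (v : Fin r → ℤ) : SmlEP {n | (A ^ n) v ∈ N} := by
  classical
  have : AddGroup.FG ((Fin r → ℤ) ⧸ N) := Module.Finite.iff_addGroup_fg.1 inferInstance
  obtain ⟨m, ι, _, p, hp, e, ⟨E⟩⟩ := AddCommGroup.equiv_free_prod_directSum_zmod ((Fin r → ℤ) ⧸ N)
  have : ∀ i, NeZero (p i ^ e i) := fun i => ⟨pow_ne_zero _ (hp i).ne_zero⟩
  let E' : ((Fin r → ℤ) ⧸ N) →ₗ[ℤ] _ := E.toAddMonoidHom.toIntLinearMap
  let F := E' ∘ₗ N.mkQ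
  have : Finite (DirectSum ι fun i => ZMod (p i ^ e i)) :=
    Finite.of_equiv _ (DirectSum.addEquivProd (fun i => ZMod (p i ^ e i))).symm.toEquiv
  have hN : ∀ x, x ∈ N ↔ F x = 0 := by
    intro x
    rw [← Submodule.Quotient.mk_eq_zero N]
    exact (map_eq_zero_iff E E.injective).symm
  have h1 : ∀ i, SmlEP {n | (Finsupp.lapply i ∘ₗ LinearMap.fst ℤ _ _ ∘ₗ F) ((A ^ n) v) = 0} :=
    fun i => sml_functional _ A _ v
  have h2 := sml_finite r A _ (LinearMap.snd ℤ _ _ ∘ₗ F) v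
  have := (SmlEP.iInter _ h1).inter h2
  convert this using 1
  ext n
  simp only [Set.mem_ofPred_eq, hN, Set.mem_inter_iff, Set.mem_iInter, LinearMap.comp_apply,
    LinearMap.fst_apply, LinearMap.snd_apply, Finsupp.lapply_apply, Prod.ext_iff]
  simp [Finsupp.ext_iff]

lemma sml_general (M : Type*) [AddCommGroup M] [Module.Finite ℤ M]
    (A : Module.End ℤ M) (N : Submodule ℤ M) (v : M) : SmlEP {n | (A ^ n) v ∈ N} := by
  obtain ⟨r, π, hπ⟩ := Module.Finite.exists_fin' ℤ M
  obtain ⟨A', hA'⟩ := Module.projective_lifting_property π (A ∘ₗ π) hπ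
  obtain ⟨v', rfl⟩ := hπ v
  have : ∀ n, π ((A' ^ n) v') = (A ^ n) (π v') := by
    intro n
    induction n with
    | zero => simp
    | succ n ih =>
      rw [pow_succ', pow_succ', Module.End.mul_apply, Module.End.mul_apply, ← ih]
      exact LinearMap.congr_fun hA' _
  convert sml_submodule r A' (N.comap π) v' using 1
  ext n
  simp [this]

lemma SmlEP.aps {S : Set ℕ} (h : SmlEP S) :
    ∃ (M : ℕ) (f : Fin M → Set ℕ), (∀ i, IsAPNat (f i)) ∧ S = ⋃ i, f i := by
  classical
  obtain ⟨d, N, hd, h⟩ := h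
  let s := (Finset.range (N + d)).filter (· ∈ S)
  let g : ℕ → Set ℕ := fun a => {n | ∃ j : ℕ, n = (if a < N then 0 else d) * j + a}
  refine ⟨s.card, fun i => g (s.equivFin.symm i).1, fun i => ⟨_, _, rfl⟩, ?_⟩
  have hs : (⋃ i, g (s.equivFin.symm i).1) = ⋃ a : s, g a.1 :=
    s.equivFin.symm.surjective.iUnion_comp (fun a : s => g a.1)
  rw [hs]
  ext n
  simp only [Set.mem_iUnion]
  constructor
  · intro hn
    by_cases hnN : n < N
    · exact ⟨⟨n, by simp only [s, Finset.mem_filter, Finset.mem_range]; exact ⟨by omega, hn⟩⟩, 0, by simp⟩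
    · have h1 := Nat.mod_add_div (n - N) d
      have h2 := Nat.mod_lt (n - N) hd
      have h3 : n = N + (n - N) % d + d * ((n - N) / d) := by omega
      refine ⟨⟨N + (n - N) % d, ?_⟩, (n - N) / d, ?_⟩
      · simp only [s, Finset.mem_filter, Finset.mem_range]
        refine ⟨by omega, ?_⟩
        rw [SmlEP.mul h ((n - N) / d) _ (by omega), ← h3]
        exact hn
      · rw [if_neg (by simp)]
        simp only
        omega
  · rintro ⟨⟨a, ha⟩, j, hj⟩
    simp only [s, Finset.mem_filter, Finset.mem_range] at ha
    simp only at hj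
    split_ifs at hj with haN
    · simp only [zero_mul, zero_add] at hj
      rw [hj]; exact ha.2
    · rw [hj, add_comm]
      exact (SmlEP.mul h j a (by omega)).1 ha.2

/-- Theorem `combinatorial theorem` part (A): Let `G` be a finitely
generated abelian group, `Φ₀ : G → G` a homomorphism satisfying a monic integer
linear recurrence, `Φ(x) = y + Φ₀(x)` an affine map, `R ∈ G` and `H ≤ G`.  Then
`S = {n : Φ^n(α) ∈ R + H}` is a finite union of arithmetic progressions. -/
theorem stmt15 {G : Type*} [AddCommGroup G] [AddGroup.FG G]
    (ℓ : ℕ) (hℓ : 1 ≤ ℓ) (c : ℕ → ℤ) (Φ₀ : G →+ G)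
    (hrec : ∀ x : G, (⇑Φ₀)^[ℓ] x + ∑ i ∈ Finset.range ℓ, c i • (⇑Φ₀)^[i] x = 0)
    (y α : G) (Φ : G → G) (hΦ : ∀ x, Φ x = y + Φ₀ x)
    (R : G) (H : AddSubgroup G) :
    ∃ (M : ℕ) (f : Fin M → Set ℕ), (∀ i, IsAPNat (f i)) ∧
      {n : ℕ | ∃ h ∈ H, Φ^[n] α = R + h} = ⋃ i, f i := by
  have : Module.Finite ℤ G := Module.Finite.iff_addGroup_fg.2 inferInstance
  apply SmlEP.aps
  let A : Module.End ℤ (G × ℤ) :=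
    LinearMap.prod ((LinearMap.toSpanSingleton ℤ G y) ∘ₗ LinearMap.snd ℤ G ℤ +
      Φ₀.toIntLinearMap ∘ₗ LinearMap.fst ℤ G ℤ) (LinearMap.snd ℤ G ℤ)
  let q : G × ℤ →ₗ[ℤ] G := LinearMap.fst ℤ G ℤ - (LinearMap.toSpanSingleton ℤ G R) ∘ₗ LinearMap.snd ℤ G ℤ
  have hA : ∀ n, (A ^ n) (α, 1) = (Φ^[n] α, 1) := by
    intro n
    induction n with
    | zero => simp
    | succ n ih =>
      rw [pow_succ', Module.End.mul_apply, ih, Function.iterate_succ_apply', hΦ]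
      simp [A]
  convert sml_general (G × ℤ) A ((AddSubgroup.toIntSubmodule H).comap q) (α, 1) using 1
  ext n
  simp only [Set.mem_ofPred_eq, hA, Submodule.mem_comap]
  have hq : q (Φ^[n] α, 1) = Φ^[n] α - R := by simp [q]
  rw [hq]
  constructor
  · rintro ⟨h, hh, e⟩
    rw [e, add_sub_cancel_left]
    exact hh
  · intro hh
    exact ⟨_, hh, by abel⟩
end
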